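/- arXiv:2602.19999 — 2 statements merged into one kernel-verified Lean document; each statement's English description precedes it below -/
import Mathlib

section
/- Let n ≥ 2, q > 2 and p ∈ ℝ. Then there exists a constant C = C(n,p,q) > 0 such that for every x₀ ∈ ℝ^n, every R > 0 and every positive classical solution u of Δu + |∇u|^q u^p = 0 on the ball B(x₀, 2R) ⊂ ℝ^n, one has sup_{B(x₀,R)} ( |∇u|^q u^{p−1} − (2nq(p+q−1)/(q−2)) · |∇u|²/u² ) ≤ C / R². -/
open scoped BigOperators

/-- The Euclidean Laplacian of `u : ℝⁿ → ℝ`, defined as the sum of the second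
partial derivatives in the coordinate directions. -/
noncomputable def elaplacian {n : ℕ} (u : EuclideanSpace ℝ (Fin n) → ℝ)
    (x : EuclideanSpace ℝ (Fin n)) : ℝ :=
  ∑ i : Fin n, fderiv ℝ (fun y => fderiv ℝ u y (EuclideanSpace.single i 1)) x
    (EuclideanSpace.single i 1)

open Filter Topology Set

section Laplacian

variable {n : ℕ}

/-- Second-order Taylor data determine the Laplacian. -/
theorem elaplacian_eq_of_hasFDerivAt {f : EuclideanSpace ℝ (Fin n) → ℝ}
    {f' : EuclideanSpace ℝ (Fin n) → EuclideanSpace ℝ (Fin n) →L[ℝ] ℝ}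
    {f'' : EuclideanSpace ℝ (Fin n) →L[ℝ] EuclideanSpace ℝ (Fin n) →L[ℝ] ℝ}
    {x : EuclideanSpace ℝ (Fin n)} (h : ∀ᶠ y in 𝓝 x, HasFDerivAt f (f' y) y)
    (h' : HasFDerivAt f' f'' x) :
    elaplacian f x = ∑ i, f'' (EuclideanSpace.single i 1) (EuclideanSpace.single i 1) := by
  unfold elaplacian
  refine Finset.sum_congr rfl fun i _ => ?_
  have h1 : (fun y => fderiv ℝ f y (EuclideanSpace.single i 1)) =ᶠ[𝓝 x]
      fun y => f' y (EuclideanSpace.single i 1) := by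
    filter_upwards [h] with y hy
    rw [hy.fderiv]
  rw [h1.fderiv_eq, (h'.clm_apply (hasFDerivAt_const _ _)).fderiv]
  simp

theorem ContDiffAt.eventually_hasFDerivAt {f : EuclideanSpace ℝ (Fin n) → ℝ}
    {x : EuclideanSpace ℝ (Fin n)} (hf : ContDiffAt ℝ 2 f x) :
    ∀ᶠ y in 𝓝 x, HasFDerivAt f (fderiv ℝ f y) y := by
  filter_upwards [hf.eventually (by simp)] with y hy
  exact (hy.differentiableAt (by simp)).hasFDerivAt

theorem ContDiffAt.hasFDerivAt_fderiv {f : EuclideanSpace ℝ (Fin n) → ℝ}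
    {x : EuclideanSpace ℝ (Fin n)} (hf : ContDiffAt ℝ 2 f x) :
    HasFDerivAt (fderiv ℝ f) (fderiv ℝ (fderiv ℝ f) x) x :=
  ((hf.fderiv_right (m := 1) (by norm_num)).differentiableAt (by simp)).hasFDerivAt

theorem ContDiffAt.continuousAt_fderiv_fderiv {f : EuclideanSpace ℝ (Fin n) → ℝ}
    {x : EuclideanSpace ℝ (Fin n)} (hf : ContDiffAt ℝ 2 f x) :
    ContinuousAt (fderiv ℝ (fderiv ℝ f)) x :=
  ((hf.fderiv_right (m := 1) (by norm_num)).fderiv_right (m := 0) (by norm_num)).continuousAt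

theorem ContDiffAt.elaplacian_eq {f : EuclideanSpace ℝ (Fin n) → ℝ}
    {x : EuclideanSpace ℝ (Fin n)} (hf : ContDiffAt ℝ 2 f x) :
    elaplacian f x = ∑ i, fderiv ℝ (fderiv ℝ f) x
      (EuclideanSpace.single i 1) (EuclideanSpace.single i 1) :=
  elaplacian_eq_of_hasFDerivAt hf.eventually_hasFDerivAt hf.hasFDerivAt_fderiv

theorem ContDiffAt.continuousAt_elaplacian {f : EuclideanSpace ℝ (Fin n) → ℝ}
    {x : EuclideanSpace ℝ (Fin n)} (hf : ContDiffAt ℝ 2 f x) :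
    ContinuousAt (elaplacian f) x := by
  have h1 : elaplacian f =ᶠ[𝓝 x] fun y => ∑ i, fderiv ℝ (fderiv ℝ f) y
      (EuclideanSpace.single i 1) (EuclideanSpace.single i 1) := by
    filter_upwards [hf.eventually (by simp)] with y hy using hy.elaplacian_eq
  refine ContinuousAt.congr ?_ h1.symm
  have := hf.continuousAt_fderiv_fderiv
  fun_prop

/-- The second derivative test: the Laplacian is nonpositive at a local maximum. -/
theorem IsLocalMax.elaplacian_nonpos {f : EuclideanSpace ℝ (Fin n) → ℝ}
    {x : EuclideanSpace ℝ (Fin n)} (hf : ContDiffAt ℝ 2 f x) (hmax : IsLocalMax f x) :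
    elaplacian f x ≤ 0 := by
  rw [hf.elaplacian_eq]
  refine Finset.sum_nonpos fun i _ => ?_
  set e : EuclideanSpace ℝ (Fin n) := EuclideanSpace.single i 1
  by_contra! hpos
  have hline : ∀ t : ℝ, HasDerivAt (fun t : ℝ => x + t • e) e t := fun t => by
    simpa using ((hasDerivAt_id t).smul_const e).const_add x
  have hcont : Tendsto (fun t : ℝ => x + t • e) (𝓝 0) (𝓝 x) := by
    have := (hline 0).continuousAt.tendsto
    simpa using this
  have hd : ∀ᶠ t : ℝ in 𝓝 0,
      HasDerivAt (fun t : ℝ => f (x + t • e)) (fderiv ℝ f (x + t • e) e) t := by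
    filter_upwards [hcont.eventually hf.eventually_hasFDerivAt] with t ht
    exact ht.comp_hasDerivAt t (hline t)
  have hderiv : deriv (fun t : ℝ => f (x + t • e)) =ᶠ[𝓝 0]
      fun t => fderiv ℝ f (x + t • e) e := by
    filter_upwards [hd] with t ht using ht.deriv
  have hdd : HasDerivAt (fun t : ℝ => fderiv ℝ f (x + t • e) e)
      (fderiv ℝ (fderiv ℝ f) x e e) 0 := by
    have h1 : HasFDerivAt (fderiv ℝ f) (fderiv ℝ (fderiv ℝ f) x) (x + (0 : ℝ) • e) := by
      simpa using hf.hasFDerivAt_fderiv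
    have h2 := h1.comp_hasDerivAt (0 : ℝ) (hline 0)
    simpa using h2.clm_apply (hasDerivAt_const (0 : ℝ) e)
  have hmax0 : IsLocalMax (fun t : ℝ => f (x + t • e)) 0 := by
    filter_upwards [hcont.eventually hmax] with t ht
    simpa using ht
  have hmin0 : IsLocalMin (fun t : ℝ => f (x + t • e)) 0 := by
    refine isLocalMin_of_deriv_deriv_pos ?_ hmax0.deriv_eq_zero
      hd.self_of_nhds.continuousAt
    rw [hderiv.deriv_eq, hdd.deriv]
    exact hpos
  have hconst : (fun t : ℝ => f (x + t • e)) =ᶠ[𝓝 0] fun _ => f (x + (0 : ℝ) • e) := by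
    filter_upwards [hmax0, hmin0] with t h1 h2 using le_antisymm h1 h2
  have h3 : deriv (deriv fun t : ℝ => f (x + t • e)) 0 = 0 := by
    rw [hconst.deriv.deriv_eq]
    simp
  rw [hderiv.deriv_eq, hdd.deriv] at h3
  exact hpos.ne' h3

theorem elaplacian_add {f g : EuclideanSpace ℝ (Fin n) → ℝ} {x : EuclideanSpace ℝ (Fin n)}
    (hf : ContDiffAt ℝ 2 f x) (hg : ContDiffAt ℝ 2 g x) :
    elaplacian (fun y => f y + g y) x = elaplacian f x + elaplacian g x := by
  rw [elaplacian_eq_of_hasFDerivAt (f' := fun y => fderiv ℝ f y + fderiv ℝ g y) _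
    (hf.hasFDerivAt_fderiv.add hg.hasFDerivAt_fderiv), hf.elaplacian_eq, hg.elaplacian_eq]
  · simp [Finset.sum_add_distrib]
  · filter_upwards [hf.eventually_hasFDerivAt, hg.eventually_hasFDerivAt] with y h1 h2
    exact h1.add h2

theorem elaplacian_const_mul (c : ℝ) {f : EuclideanSpace ℝ (Fin n) → ℝ}
    {x : EuclideanSpace ℝ (Fin n)} (hf : ContDiffAt ℝ 2 f x) :
    elaplacian (fun y => c * f y) x = c * elaplacian f x := by
  rw [elaplacian_eq_of_hasFDerivAt (f' := fun y => c • fderiv ℝ f y) _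
    (hf.hasFDerivAt_fderiv.const_smul c), hf.elaplacian_eq]
  · simp [Finset.mul_sum]
  · filter_upwards [hf.eventually_hasFDerivAt] with y h1
    exact h1.const_mul c

theorem elaplacian_sub {f g : EuclideanSpace ℝ (Fin n) → ℝ} {x : EuclideanSpace ℝ (Fin n)}
    (hf : ContDiffAt ℝ 2 f x) (hg : ContDiffAt ℝ 2 g x) :
    elaplacian (fun y => f y - g y) x = elaplacian f x - elaplacian g x := by
  rw [elaplacian_eq_of_hasFDerivAt (f' := fun y => fderiv ℝ f y - fderiv ℝ g y) _
    (hf.hasFDerivAt_fderiv.sub hg.hasFDerivAt_fderiv), hf.elaplacian_eq, hg.elaplacian_eq]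
  · simp [Finset.sum_sub_distrib]
  · filter_upwards [hf.eventually_hasFDerivAt, hg.eventually_hasFDerivAt] with y h1 h2
    exact h1.sub h2

/-- The squared norm of the gradient in terms of the coordinate derivatives. -/
theorem norm_gradient_sq (f : EuclideanSpace ℝ (Fin n) → ℝ) (x : EuclideanSpace ℝ (Fin n)) :
    ‖gradient f x‖ ^ 2 = ∑ i, fderiv ℝ f x (EuclideanSpace.single i 1) ^ 2 := by
  rw [← (EuclideanSpace.basisFun (Fin n) ℝ).sum_sq_norm_inner_left]
  simp [gradient]

/-- The chain rule for the Laplacian. -/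
theorem elaplacian_comp {f : EuclideanSpace ℝ (Fin n) → ℝ} {φ φ' : ℝ → ℝ} {φ'' : ℝ}
    {x : EuclideanSpace ℝ (Fin n)} (hf : ContDiffAt ℝ 2 f x)
    (hφ : ∀ᶠ s in 𝓝 (f x), HasDerivAt φ (φ' s) s) (hφ' : HasDerivAt φ' φ'' (f x)) :
    elaplacian (fun y => φ (f y)) x
      = φ' (f x) * elaplacian f x + φ'' * ‖gradient f x‖ ^ 2 := by
  rw [elaplacian_eq_of_hasFDerivAt (f' := fun y => φ' (f y) • fderiv ℝ f y) _
    ((hφ'.comp_hasFDerivAt x (hf.differentiableAt (by simp)).hasFDerivAt).smul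
      hf.hasFDerivAt_fderiv), hf.elaplacian_eq, norm_gradient_sq]
  · simp [Finset.mul_sum, Finset.sum_add_distrib, sq, mul_assoc]
  · filter_upwards [hf.eventually_hasFDerivAt, hf.continuousAt.eventually hφ] with y h1 h2
    exact h2.comp_hasFDerivAt y h1

/-- The product rule for the Laplacian, at a critical zero of the second factor. -/
theorem elaplacian_mul_of_critical {f g : EuclideanSpace ℝ (Fin n) → ℝ}
    {x : EuclideanSpace ℝ (Fin n)} (hf : ContDiffAt ℝ 2 f x) (hg : ContDiffAt ℝ 2 g x)
    (h0 : g x = 0) (h1 : fderiv ℝ g x = 0) :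
    elaplacian (fun y => f y * g y) x = f x * elaplacian g x := by
  rw [elaplacian_eq_of_hasFDerivAt (f' := fun y => f y • fderiv ℝ g y + g y • fderiv ℝ f y) _
    (((hf.differentiableAt (by simp)).hasFDerivAt.smul hg.hasFDerivAt_fderiv).add
      ((hg.differentiableAt (by simp)).hasFDerivAt.smul hf.hasFDerivAt_fderiv)),
      hg.elaplacian_eq]
  · simp [Finset.mul_sum, h0, h1]
  · filter_upwards [hf.eventually_hasFDerivAt, hg.eventually_hasFDerivAt] with y h1 h2
    exact h1.mul h2

/-- The Laplacian of a function composed with an affine map. -/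
theorem elaplacian_comp_affine {f : EuclideanSpace ℝ (Fin n) → ℝ}
    {φ : EuclideanSpace ℝ (Fin n) → EuclideanSpace ℝ (Fin n)}
    {M : EuclideanSpace ℝ (Fin n) →L[ℝ] EuclideanSpace ℝ (Fin n)}
    {x : EuclideanSpace ℝ (Fin n)} (hφ : ∀ y, HasFDerivAt φ M y)
    (hf : ContDiffAt ℝ 2 f (φ x)) :
    elaplacian (fun y => f (φ y)) x = ∑ i, fderiv ℝ (fderiv ℝ f) (φ x)
      (M (EuclideanSpace.single i 1)) (M (EuclideanSpace.single i 1)) := by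
  rw [elaplacian_eq_of_hasFDerivAt (f' := fun y => (fderiv ℝ f (φ y)).comp M) _
    ((hf.hasFDerivAt_fderiv.comp x (hφ x)).clm_comp (hasFDerivAt_const M x))]
  · simp
  · filter_upwards [(hφ x).continuousAt.eventually hf.eventually_hasFDerivAt] with y h1
    exact h1.comp y (hφ y)

/-- The Laplacian of the squared norm of an affine map. -/
theorem elaplacian_norm_sq_affine
    {φ : EuclideanSpace ℝ (Fin n) → EuclideanSpace ℝ (Fin n)}
    {M : EuclideanSpace ℝ (Fin n) →L[ℝ] EuclideanSpace ℝ (Fin n)}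
    (x : EuclideanSpace ℝ (Fin n)) (hφ : ∀ y, HasFDerivAt φ M y) :
    elaplacian (fun y => ‖φ y‖ ^ 2) x = 2 * ∑ i, ‖M (EuclideanSpace.single i 1)‖ ^ 2 := by
  have h2 : HasFDerivAt (fun y => 2 • (innerSL ℝ (φ y)).comp M) _ x :=
    ((((innerSL ℝ).hasFDerivAt.comp x (hφ x)).clm_comp
      (hasFDerivAt_const M x)).const_smul (2 : ℕ))
  rw [elaplacian_eq_of_hasFDerivAt (Eventually.of_forall fun y => (hφ y).norm_sq) h2]
  have h3 : ∀ z : EuclideanSpace ℝ (Fin n), innerSL ℝ z z = ‖z‖ ^ 2 := real_inner_self_eq_norm_sq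
  simp [Finset.mul_sum, h3]

/-- Difference quotients of a strictly differentiable function along a continuous vector field
converge locally uniformly. -/
theorem HasStrictFDerivAt.tendsto_slope_vectorField {f : EuclideanSpace ℝ (Fin n) → ℝ}
    {f' : EuclideanSpace ℝ (Fin n) →L[ℝ] ℝ}
    {b : EuclideanSpace ℝ (Fin n) → EuclideanSpace ℝ (Fin n)} {x : EuclideanSpace ℝ (Fin n)}
    (hf : HasStrictFDerivAt f f' x) (hb : ContinuousAt b x) :
    Tendsto (fun z : ℝ × EuclideanSpace ℝ (Fin n) =>
        z.1⁻¹ * (f (z.2 + z.1 • b z.2) - f z.2))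
      (𝓝[{z | 0 < z.1}] (0, x)) (𝓝 (f' (b x))) := by
  have hb2 : ContinuousAt (fun z : ℝ × EuclideanSpace ℝ (Fin n) => b z.2) (0, x) :=
    ContinuousAt.comp (f := Prod.snd) (x := ((0 : ℝ), x)) hb continuousAt_snd
  have hφ : Tendsto (fun z : ℝ × EuclideanSpace ℝ (Fin n) => (z.2 + z.1 • b z.2, z.2))
      (𝓝[{z | 0 < z.1}] (0, x)) (𝓝 (x, x)) := by
    have h : ContinuousAt (fun z : ℝ × EuclideanSpace ℝ (Fin n) =>
        (z.2 + z.1 • b z.2, z.2)) (0, x) := by fun_prop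
    simpa using h.tendsto.mono_left nhdsWithin_le_nhds
  have h1 := hf.isLittleO.comp_tendsto hφ
  have h2 : (fun z : ℝ × EuclideanSpace ℝ (Fin n) => z.1 • b z.2)
      =O[𝓝[{z | 0 < z.1}] (0, x)] fun z => z.1 := by
    have h3 : (fun z : ℝ × EuclideanSpace ℝ (Fin n) => b z.2)
        =O[𝓝[{z | 0 < z.1}] (0, x)] fun _ => (1 : ℝ) :=
      (hb2.tendsto.mono_left nhdsWithin_le_nhds).isBigO_one ℝ
    simpa using (Asymptotics.isBigO_refl (fun z : ℝ × EuclideanSpace ℝ (Fin n) => z.1)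
      (𝓝[{z | 0 < z.1}] (0, x))).smul h3
  have h4 := (h1.trans_isBigO (by simpa [Function.comp_def] using h2)).tendsto_div_nhds_zero
  have h5 : Tendsto (fun z : ℝ × EuclideanSpace ℝ (Fin n) => f' (b z.2))
      (𝓝[{z | 0 < z.1}] (0, x)) (𝓝 (f' (b x))) :=
    (f'.continuous.continuousAt.comp hb2).tendsto.mono_left nhdsWithin_le_nhds
  have h6 := h4.add h5
  rw [zero_add] at h6
  refine h6.congr' ?_
  filter_upwards [self_mem_nhdsWithin] with z hz
  have hz : z.1 ≠ 0 := ne_of_gt hz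
  simp only [Function.comp, add_sub_cancel_left, map_smul, smul_eq_mul]
  field_simp
  ring

theorem inner_gradient (f : EuclideanSpace ℝ (Fin n) → ℝ) (x y : EuclideanSpace ℝ (Fin n)) :
    inner ℝ (gradient f x) y = fderiv ℝ f x y := by
  simp [gradient]

/-- Bochner's inequality in the viscosity sense, for functions touching the squared gradient
strictly from above. -/
theorem bochner_of_touching_strict {v g ψ : EuclideanSpace ℝ (Fin n) → ℝ}
    {g' : EuclideanSpace ℝ (Fin n) →L[ℝ] ℝ} {x₀ : EuclideanSpace ℝ (Fin n)}
    (hv : ContDiffAt ℝ 2 v x₀) (hg : HasStrictFDerivAt g g' x₀)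
    (hvg : ∀ᶠ x in 𝓝 x₀, elaplacian v x = g x) (hψ : ContDiffAt ℝ 2 ψ x₀)
    (hle : ∀ᶠ x in 𝓝 x₀, x ≠ x₀ → ‖gradient v x‖ ^ 2 < ψ x)
    (heq : ‖gradient v x₀‖ ^ 2 = ψ x₀) :
    2 * (g x₀ ^ 2 / n) + 2 * g' (gradient v x₀) ≤ elaplacian ψ x₀ := by
  set e : Fin n → EuclideanSpace ℝ (Fin n) := fun i => EuclideanSpace.single i 1 with he
  set B : EuclideanSpace ℝ (Fin n) →L[ℝ] EuclideanSpace ℝ (Fin n) :=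
    LinearMap.toContinuousLinearMap
      { toFun := fun y => (InnerProductSpace.toDual ℝ _).symm (fderiv ℝ (fderiv ℝ v) x₀ y)
        map_add' := fun y z => by simp
        map_smul' := fun c y => by simp } with hB
  have hBi : ∀ y z, inner ℝ (B y) z = fderiv ℝ (fderiv ℝ v) x₀ y z := fun y z => by
    simp [hB]
  set p := gradient v x₀ with hp
  set b : EuclideanSpace ℝ (Fin n) → EuclideanSpace ℝ (Fin n) :=
    fun x => p + B (x - x₀) with hb
  have hbd : ∀ y, HasFDerivAt b B y := fun y =>
    (B.hasFDerivAt.comp y ((hasFDerivAt_id y).sub_const x₀)).const_add p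
  have hbc : Continuous b := by fun_prop
  have hb0 : b x₀ = p := by simp [hb]
  have hφd : ∀ (t : ℝ) y, HasFDerivAt (fun x => x + t • b x)
      (ContinuousLinearMap.id ℝ _ + t • B) y := fun t y =>
    (hasFDerivAt_id y).add ((hbd y).const_smul t)
  have hφc : Tendsto (fun z : ℝ × EuclideanSpace ℝ (Fin n) => z.2 + z.1 • b z.2)
      (𝓝 (0, x₀)) (𝓝 x₀) := by
    have h : ContinuousAt (fun z : ℝ × EuclideanSpace ℝ (Fin n) => z.2 + z.1 • b z.2)
      (0, x₀) := by fun_prop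
    simpa using h.tendsto
  set S : ℝ := ∑ i, ‖B (e i)‖ ^ 2 with hS
  have hSg : g x₀ ^ 2 / n ≤ S := by
    rcases Nat.eq_zero_or_pos n with hn | hn
    · subst hn
      simpa using Finset.sum_nonneg fun i _ => by positivity
    rw [div_le_iff₀' (by positivity), ← hvg.self_of_nhds, hv.elaplacian_eq]
    refine sq_sum_le_card_mul_sum_sq.trans ?_
    simp only [Finset.card_univ, Fintype.card_fin, hS]
    refine mul_le_mul_of_nonneg_left (Finset.sum_le_sum fun i _ => ?_) (by positivity)
    rw [← hBi]
    have h1 := abs_real_inner_le_norm (B (e i)) (e i)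
    have h2 : ‖e i‖ = 1 := by simp [he]
    rw [h2, mul_one] at h1
    rwa [sq_le_sq, abs_norm]
  suffices h : 2 * S + 2 * g' p ≤ elaplacian ψ x₀ by linarith
  by_contra! hlt
  set h : ℝ → EuclideanSpace ℝ (Fin n) → ℝ := fun t x =>
    (2 * t⁻¹) * (v (x + t • b x) - v x) - ‖b x‖ ^ 2 - ψ x with hh
  -- regularity and the Laplacian of the difference quotients
  have hreg : ∀ᶠ z : ℝ × EuclideanSpace ℝ (Fin n) in 𝓝 (0, x₀),
      ContDiffAt ℝ 2 (h z.1) z.2 ∧ elaplacian (h z.1) z.2 =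
        (2 * z.1⁻¹) * (∑ i, fderiv ℝ (fderiv ℝ v) (z.2 + z.1 • b z.2)
          (e i + z.1 • B (e i)) (e i + z.1 • B (e i)) - elaplacian v z.2)
          - 2 * S - elaplacian ψ z.2 := by
    have hs : Tendsto (Prod.snd : ℝ × EuclideanSpace ℝ (Fin n) → _) (𝓝 (0, x₀)) (𝓝 x₀) :=
      continuousAt_snd
    filter_upwards [hφc.eventually (hv.eventually (by simp)),
      hs.eventually (hv.eventually (by simp)), hs.eventually (hψ.eventually (by simp))]
      with z h1 h2 h3
    have hbC : ContDiffAt ℝ 2 b z.2 := by fun_prop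
    have h1' : ContDiffAt ℝ 2 (fun x => v (x + z.1 • b x)) z.2 :=
      ContDiffAt.comp (g := v) (f := fun x => x + z.1 • b x) z.2 h1 (by fun_prop)
    have h4 : ContDiffAt ℝ 2 (fun x => ‖b x‖ ^ 2) z.2 := hbC.norm_sq ℝ
    have h5 : ContDiffAt ℝ 2 (fun x => v (x + z.1 • b x) - v x) z.2 := h1'.sub h2
    have h6 : ContDiffAt ℝ 2 (fun x => (2 * z.1⁻¹) * (v (x + z.1 • b x) - v x)) z.2 :=
      contDiffAt_const.mul h5
    refine ⟨(h6.sub h4).sub h3, ?_⟩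
    rw [hh, elaplacian_sub (h6.sub h4) h3, elaplacian_sub h6 h4, elaplacian_const_mul _ h5,
      elaplacian_sub h1' h2, elaplacian_norm_sq_affine _ hbd,
      elaplacian_comp_affine (hφd z.1) h1]
    simp [hS, he]
  have hlim : Tendsto (fun z : ℝ × EuclideanSpace ℝ (Fin n) => elaplacian (h z.1) z.2)
      (𝓝[{z | 0 < z.1}] (0, x₀)) (𝓝 (2 * g' p + 4 * S + 2 * 0 - 2 * S - elaplacian ψ x₀)) := by
    have hs : Tendsto (Prod.snd : ℝ × EuclideanSpace ℝ (Fin n) → _)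
      (𝓝[{z | 0 < z.1}] (0, x₀)) (𝓝 x₀) :=
      continuousAt_snd.tendsto.mono_left nhdsWithin_le_nhds
    have hf : Tendsto (Prod.fst : ℝ × EuclideanSpace ℝ (Fin n) → _)
      (𝓝[{z | 0 < z.1}] (0, x₀)) (𝓝 0) :=
      continuousAt_fst.tendsto.mono_left nhdsWithin_le_nhds
    have hφw := hφc.mono_left (nhdsWithin_le_nhds (s := {z | 0 < z.1}))
    have l1 := hg.tendsto_slope_vectorField hbc.continuousAt
    rw [hb0] at l1
    have lD : Tendsto (fun z : ℝ × EuclideanSpace ℝ (Fin n) =>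
        fderiv ℝ (fderiv ℝ v) (z.2 + z.1 • b z.2)) (𝓝[{z | 0 < z.1}] (0, x₀))
        (𝓝 (fderiv ℝ (fderiv ℝ v) x₀)) :=
      hv.continuousAt_fderiv_fderiv.tendsto.comp hφw
    have lDa : ∀ y y' : EuclideanSpace ℝ (Fin n),
        Tendsto (fun z : ℝ × EuclideanSpace ℝ (Fin n) =>
        fderiv ℝ (fderiv ℝ v) (z.2 + z.1 • b z.2) y y') (𝓝[{z | 0 < z.1}] (0, x₀))
        (𝓝 (fderiv ℝ (fderiv ℝ v) x₀ y y')) := fun y y' =>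
      ((ContinuousLinearMap.apply ℝ ℝ y').continuous.tendsto _).comp
        (((ContinuousLinearMap.apply ℝ _ y).continuous.tendsto _).comp lD)
    have l2 : Tendsto (fun z : ℝ × EuclideanSpace ℝ (Fin n) =>
        ∑ i, fderiv ℝ (fderiv ℝ v) (z.2 + z.1 • b z.2) (e i) (B (e i)))
        (𝓝[{z | 0 < z.1}] (0, x₀)) (𝓝 S) := by
      have := tendsto_finsetSum Finset.univ fun i _ => lDa (e i) (B (e i))
      simpa only [← hBi, real_inner_self_eq_norm_sq] using this
    have l3 := hf.mul (tendsto_finsetSum Finset.univ fun i _ => lDa (B (e i)) (B (e i)))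
    rw [zero_mul] at l3
    have l4 := hψ.continuousAt_elaplacian.tendsto.comp hs
    refine (((((l1.const_mul 2).add (l2.const_mul 4)).add (l3.const_mul 2)).sub_const
      (2 * S)).sub l4).congr' ?_
    filter_upwards [nhdsWithin_le_nhds hreg, self_mem_nhdsWithin, hs.eventually hvg,
      hφw.eventually hvg, hφw.eventually (hv.eventually (by simp))] with z h1 h2 h3 h4 h5
    have hz : z.1 ≠ 0 := ne_of_gt h2
    rw [h1.2, h3, ← h4, h5.elaplacian_eq]
    have hsym : ∀ i, fderiv ℝ (fderiv ℝ v) (z.2 + z.1 • b z.2) (B (e i)) (e i)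
        = fderiv ℝ (fderiv ℝ v) (z.2 + z.1 • b z.2) (e i) (B (e i)) := fun i =>
      h5.isSymmSndFDerivAt (by simp) _ _
    simp only [map_add, add_apply, map_smul, smul_apply,
      Finset.sum_add_distrib, smul_eq_mul, ← Finset.mul_sum, hsym, Function.comp]
    field_simp
    ring
  have hpos : ∀ᶠ z : ℝ × EuclideanSpace ℝ (Fin n) in 𝓝 (0, x₀), 0 < z.1 →
      0 < elaplacian (h z.1) z.2 :=
    eventually_nhdsWithin_iff.mp (hlim.eventually_const_lt (by linarith))
  -- a ball on which everything holds
  obtain ⟨T, hT, U, hU, hTU⟩ : ∃ T ∈ 𝓝 (0 : ℝ), ∃ U ∈ 𝓝 x₀, ∀ t ∈ T, ∀ x ∈ U,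
      ContDiffAt ℝ 2 (h t) x ∧ (0 < t → 0 < elaplacian (h t) x) := by
    rw [nhds_prod_eq] at hreg hpos
    obtain ⟨T, hT, U, hU, hTU⟩ := Filter.mem_prod_iff.mp (hreg.and hpos)
    exact ⟨T, hT, U, hU, fun t ht x hx => ⟨(hTU (mk_mem_prod ht hx)).1.1,
      (hTU (mk_mem_prod ht hx)).2⟩⟩
  obtain ⟨r, hr, hball⟩ := Metric.nhds_basis_closedBall.eventually_iff.mp
    ((eventually_mem_set.mpr hU).and (hle.and (hv.eventually (by simp) |>.and
      (hψ.eventually (by simp)))))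
  have h_slope : ∀ x ∈ Metric.closedBall x₀ r,
      Tendsto (fun z : ℝ × EuclideanSpace ℝ (Fin n) => h z.1 z.2)
      (𝓝[{z | 0 < z.1}] (0, x)) (𝓝 (2 * fderiv ℝ v x (b x) - ‖b x‖ ^ 2 - ψ x)) := by
    intro x hx
    have hs : Tendsto (Prod.snd : ℝ × EuclideanSpace ℝ (Fin n) → _)
      (𝓝[{z | 0 < z.1}] (0, x)) (𝓝 x) :=
      continuousAt_snd.tendsto.mono_left nhdsWithin_le_nhds
    obtain ⟨-, -, h3, h4⟩ := hball hx
    have l1 := (h3.hasStrictFDerivAt (by simp)).tendsto_slope_vectorField hbc.continuousAt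
    have l2 := ((hbc.norm.pow 2).continuousAt.tendsto.comp hs)
    refine (((l1.const_mul 2).sub l2).sub (h4.continuousAt.tendsto.comp hs)).congr fun z => ?_
    simp [hh, mul_assoc]
  have hneg : ∀ x ∈ Metric.sphere x₀ r, 2 * fderiv ℝ v x (b x) - ‖b x‖ ^ 2 - ψ x < 0 := by
    intro x hx
    have hxne : x ≠ x₀ := by
      rintro rfl
      simp at hx
      exact hr.ne hx
    have h1 := (hball (Metric.sphere_subset_closedBall hx)).2.1 hxne
    have h2 := norm_sub_sq_real (gradient v x) (b x)
    rw [inner_gradient] at h2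
    nlinarith [sq_nonneg ‖gradient v x - b x‖]
  obtain ⟨c, hc0, hc⟩ : ∃ c < 0, ∀ x ∈ Metric.sphere x₀ r,
      2 * fderiv ℝ v x (b x) - ‖b x‖ ^ 2 - ψ x < c := by
    rcases (Metric.sphere x₀ r).eq_empty_or_nonempty with hE | hE
    · exact ⟨-1, by norm_num, by simp [hE]⟩
    have hcont : ContinuousOn (fun x => 2 * fderiv ℝ v x (b x) - ‖b x‖ ^ 2 - ψ x)
        (Metric.sphere x₀ r) := by
      intro x hx
      obtain ⟨-, -, h3, h4⟩ := hball (Metric.sphere_subset_closedBall hx)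
      have h5 : ContinuousAt (fderiv ℝ v) x :=
        (h3.fderiv_right (m := 1) (by norm_num)).continuousAt
      have h6 := h4.continuousAt
      exact ContinuousAt.continuousWithinAt (by fun_prop)
    obtain ⟨m, hm, hmax⟩ := (isCompact_sphere x₀ r).exists_isMaxOn hE hcont
    refine ⟨_, by linarith [hneg m hm], fun x hx => (hmax hx).trans_lt
      (show _ < (2 * fderiv ℝ v m (b m) - ‖b m‖ ^ 2 - ψ m) / 2 by linarith [hneg m hm])⟩
  have hsphere : ∀ᶠ t : ℝ in 𝓝 0, ∀ x ∈ Metric.sphere x₀ r, 0 < t → h t x < c :=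
    (isCompact_sphere x₀ r).eventually_forall_of_forall_eventually fun x hx =>
      eventually_nhdsWithin_iff.mp
        ((h_slope x (Metric.sphere_subset_closedBall hx)).eventually_lt_const (hc x hx))
  have hcenter : ∀ᶠ t : ℝ in 𝓝 0, 0 < t → c < h t x₀ := by
    have h1 := (h_slope x₀ (Metric.mem_closedBall_self hr.le)).eventually_const_lt
      (show c < _ by
        rw [hb0, ← inner_gradient, ← hp, real_inner_self_eq_norm_sq, ← heq]
        linarith)
    have h2 : Tendsto (fun t : ℝ => (t, x₀)) (𝓝 0) (𝓝 (0, x₀)) :=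
      (by fun_prop : Continuous fun t : ℝ => (t, x₀)).tendsto 0
    exact h2.eventually (eventually_nhdsWithin_iff.mp h1)
  obtain ⟨t, ⟨⟨htT, ht1⟩, ht2⟩, ht0⟩ := ((((eventually_mem_set.mpr hT).and hsphere).and
    hcenter).filter_mono nhdsWithin_le_nhds |>.and
      (self_mem_nhdsWithin : ∀ᶠ t in 𝓝[>] (0 : ℝ), t ∈ Ioi 0)).exists
  have hcontt : ContinuousOn (h t) (Metric.closedBall x₀ r) := fun x hx =>
    (hTU t htT x (hball hx).1).1.continuousAt.continuousWithinAt
  obtain ⟨y, hy, hymax⟩ := (isCompact_closedBall x₀ r).exists_isMaxOn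
    ⟨x₀, Metric.mem_closedBall_self hr.le⟩ hcontt
  have hyball : y ∈ Metric.ball x₀ r := by
    rcases (Metric.mem_closedBall.mp hy).lt_or_eq with h1 | h1
    · exact h1
    · have h2 := ht1 y h1 ht0
      have h3 := ht2 ht0
      have h4 : h t x₀ ≤ h t y := hymax (Metric.mem_closedBall_self hr.le)
      linarith
  have hloc : IsLocalMax (h t) y :=
    hymax.isLocalMax (mem_of_superset (Metric.isOpen_ball.mem_nhds hyball)
      Metric.ball_subset_closedBall)
  have h1 := hTU t htT y (hball hy).1
  exact absurd (hloc.elaplacian_nonpos h1.1) (not_le.mpr (h1.2 ht0))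

/-- Bochner's inequality in the viscosity sense: only two derivatives of `v` are needed. -/
theorem bochner_of_touching {v g ψ : EuclideanSpace ℝ (Fin n) → ℝ}
    {g' : EuclideanSpace ℝ (Fin n) →L[ℝ] ℝ} {x₀ : EuclideanSpace ℝ (Fin n)}
    (hv : ContDiffAt ℝ 2 v x₀) (hg : HasStrictFDerivAt g g' x₀)
    (hvg : ∀ᶠ x in 𝓝 x₀, elaplacian v x = g x) (hψ : ContDiffAt ℝ 2 ψ x₀)
    (hle : ∀ᶠ x in 𝓝 x₀, ‖gradient v x‖ ^ 2 ≤ ψ x)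
    (heq : ‖gradient v x₀‖ ^ 2 = ψ x₀) :
    2 * (g x₀ ^ 2 / n) + 2 * g' (gradient v x₀) ≤ elaplacian ψ x₀ := by
  have hsq : ContDiffAt ℝ 2 (fun x => ‖x - x₀‖ ^ 2) x₀ :=
    (contDiffAt_id.sub contDiffAt_const).norm_sq ℝ
  have key : ∀ δ > 0, 2 * (g x₀ ^ 2 / n) + 2 * g' (gradient v x₀)
      ≤ elaplacian ψ x₀ + δ * (2 * n) := by
    intro δ hδ
    have h1 := bochner_of_touching_strict hv hg hvg
      (ψ := fun x => ψ x + δ * ‖x - x₀‖ ^ 2) (hψ.add (contDiffAt_const.mul hsq)) ?_ (by simpa)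
    · rw [elaplacian_add hψ (contDiffAt_const.mul hsq), elaplacian_const_mul _ hsq,
        elaplacian_norm_sq_affine (φ := fun y => y - x₀) x₀
          fun y => (hasFDerivAt_id y).sub_const x₀] at h1
      simpa using h1
    · filter_upwards [hle] with x hx hne
      have : 0 < ‖x - x₀‖ := norm_pos_iff.mpr (sub_ne_zero.mpr hne)
      have : 0 < δ * ‖x - x₀‖ ^ 2 := by positivity
      linarith
  have hlim : Tendsto (fun δ : ℝ => elaplacian ψ x₀ + δ * (2 * n)) (𝓝[>] 0)
      (𝓝 (elaplacian ψ x₀)) := by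
    have : Continuous fun δ : ℝ => elaplacian ψ x₀ + δ * (2 * n) := by fun_prop
    simpa using (this.tendsto 0).mono_left nhdsWithin_le_nhds
  exact ge_of_tendsto hlim (by filter_upwards [self_mem_nhdsWithin] with δ hδ using key δ hδ)

/-- The control function dominates the drift term in the Bochner inequality. -/
theorem mul_sub_le_mul_sq {n a r f w : ℝ} (hn : 1 ≤ n) (ha : 1 < a) (hw : 0 < w) (hf : 0 < f)
    (hF : 2 * n * a * r * w < f) :
    n * (r * (a - 1)) * f * w * (f - w) ≤ (a * f - 2 * n * a * r * w) * (f + w) ^ 2 := by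
  have ha1 : 0 < a - 1 := by linarith
  have hn0 : 0 < n := by linarith
  rcases le_or_gt 0 r with hr0 | hr0
  · have h5 : n * (r * (a - 1)) * w ≤ a * f - 2 * n * a * r * w := by
      have h6 : 0 ≤ n * r * w * ((a - 1) * (2 * a - 1)) :=
        mul_nonneg (by positivity) (mul_nonneg ha1.le (by linarith))
      have h7 : 0 ≤ a * (f - 2 * n * a * r * w) := mul_nonneg (by linarith) (by linarith)
      linear_combination h6 + h7
    have h6 : 0 ≤ n * (r * (a - 1)) * w := by positivity
    have h7 : f * (f - w) ≤ (f + w) ^ 2 := by nlinarith [mul_pos hf hw]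
    calc n * (r * (a - 1)) * f * w * (f - w) = n * (r * (a - 1)) * w * (f * (f - w)) := by ring
      _ ≤ n * (r * (a - 1)) * w * (f + w) ^ 2 := by gcongr
      _ ≤ _ := by gcongr
  · have h5 : n * (-r * (a - 1)) * w ≤ a * f - 2 * n * a * r * w := by
      have h6 : 0 ≤ n * w * (-r) * (a + 1) := by
        have : 0 ≤ -r := by linarith
        positivity
      have h7 : 0 ≤ a * f := by positivity
      linear_combination h6 + h7
    have h6 : 0 ≤ n * (-r * (a - 1)) * w := by
      have : 0 ≤ -r := by linarith
      positivity
    have h7 : f * (w - f) ≤ (f + w) ^ 2 := by nlinarith [mul_pos hf hw]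
    calc n * (r * (a - 1)) * f * w * (f - w) = n * (-r * (a - 1)) * w * (f * (w - f)) := by ring
      _ ≤ n * (-r * (a - 1)) * w * (f + w) ^ 2 := by gcongr
      _ ≤ _ := by gcongr

/-- The algebraic part of the estimate: the Bochner inequality at a maximum point of the
localized control function bounds `(f + w)² / w`. -/
theorem sq_add_le_of_bochner {n a s A f w F P X Y Z ε τ : ℝ} (hn : 1 ≤ n) (ha : 1 < a)
    (hA : A * (a - 1) = 2 * n * a * s) (hw : 0 < w) (hf : 0 < f) (hF : F = f - A * w)
    (hFpos : 0 < F) (hP : P = a * f - A * w) (hX : P * X = F * Z - s * f * w)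
    (hCS : 0 ≤ Y + 2 * (s / (a - 1)) * X + (s / (a - 1)) ^ 2 * w) (hZ : Z ^ 2 ≤ ε * w)
    (hmain : P * (2 * ((f + w) ^ 2 / n) - 2 * (X * (w + a * f) + s * f * w))
      + w * f * (a * (a - 1) * Y + 2 * a * s * X + s ^ 2 * w - s * (w + f)) ≤ F * τ * w) :
    (f + w) ^ 2 ≤ w * (4 * n ^ 2 * a ^ 2 * ε + 2 * n * τ) := by
  have ha1 : 0 < a - 1 := by linarith
  have hn0 : 0 < n := by linarith
  have hPF : F ≤ P := by rw [hF, hP]; nlinarith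
  have hP0 : 0 < P := hFpos.trans_le hPF
  obtain ⟨r, hr⟩ : ∃ r, r = s / (a - 1) := ⟨_, rfl⟩
  have hsr : s = r * (a - 1) := by rw [hr]; field_simp
  have hAr : A = 2 * n * a * r := by
    have : A * (a - 1) = (2 * n * a * r) * (a - 1) := by rw [hA, hsr]; ring
    exact mul_right_cancel₀ ha1.ne' this
  rw [← hr] at hCS
  have h1 : -(s * r * w) ≤ a * (a - 1) * Y + 2 * a * s * X + s ^ 2 * w := by
    have := mul_nonneg (mul_nonneg (by linarith : 0 ≤ a) ha1.le) hCS
    rw [hsr]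
    linarith
  have h2 : P * (2 * ((f + w) ^ 2 / n)) + s * f * w ^ 2 + (2 * A * s - s * r) * (f * w ^ 2)
      - s * f ^ 2 * w ≤ F * τ * w + 2 * F * Z * (w + a * f) := by
    have h3 := mul_le_mul_of_nonneg_left h1 (mul_pos hw hf).le
    have h4 : P * X * (w + a * f) = (F * Z - s * f * w) * (w + a * f) := by rw [hX]
    have h5 : P * (s * f * w) = (a * f - A * w) * (s * f * w) := by rw [hP]
    linarith
  have h3 : 0 ≤ 2 * A * s - s * r := by
    have : 2 * A * s - s * r = r ^ 2 * ((a - 1) * (4 * n * a - 1)) := by rw [hAr, hsr]; ring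
    rw [this]
    have : 1 ≤ n * a := by nlinarith
    have : 0 ≤ 4 * n * a - 1 := by linarith
    positivity
  have h4 : n * s * f * w * (f - w) ≤ P * (f + w) ^ 2 := by
    rw [hP, hAr, hsr]
    exact mul_sub_le_mul_sq hn ha hw hf (by rw [← hAr]; linarith)
  have h5 : P * ((f + w) ^ 2 / n) ≤ F * (τ * w + 2 * Z * (w + a * f)) := by
    have h6 : s * f * w * (f - w) ≤ P * ((f + w) ^ 2 / n) := by
      rw [← mul_div_assoc, le_div_iff₀ hn0]
      linarith
    have h7 := mul_nonneg h3 (by positivity : 0 ≤ f * w ^ 2)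
    linarith
  have h6 : (f + w) ^ 2 / n ≤ τ * w + 2 * Z * (w + a * f) := by
    refine le_of_mul_le_mul_left (le_trans ?_ h5) hFpos
    gcongr
  have h7 : 2 * Z * (w + a * f) ≤ (f + w) ^ 2 / (2 * n) + 2 * n * a ^ 2 * (ε * w) := by
    have h8 : 2 * Z * (w + a * f) ≤ 2 * |Z| * (a * (f + w)) := by
      have h9 := le_abs_self Z
      have h10 := abs_nonneg Z
      have h11 : w + a * f ≤ a * (f + w) := by nlinarith
      have h12 : 0 ≤ w + a * f := by positivity
      calc 2 * Z * (w + a * f) ≤ 2 * |Z| * (w + a * f) := by gcongr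
        _ ≤ _ := by gcongr
    have h9 : (f + w) ^ 2 / (2 * n) + 2 * n * a ^ 2 * |Z| ^ 2 - 2 * |Z| * (a * (f + w))
        = (f + w - 2 * n * a * |Z|) ^ 2 / (2 * n) := by
      field_simp
      ring
    have h10 : 0 ≤ (f + w - 2 * n * a * |Z|) ^ 2 / (2 * n) := by positivity
    have h11 : 2 * n * a ^ 2 * |Z| ^ 2 ≤ 2 * n * a ^ 2 * (ε * w) := by
      rw [sq_abs]
      gcongr
    linarith
  have h8 : (f + w) ^ 2 / n = 2 * ((f + w) ^ 2 / (2 * n)) := by field_simp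
  have h9 : (f + w) ^ 2 / (2 * n) ≤ τ * w + 2 * n * a ^ 2 * (ε * w) := by linarith
  rw [div_le_iff₀ (by positivity)] at h9
  linarith

theorem gradient_eq_of_hasFDerivAt_inner {f : EuclideanSpace ℝ (Fin n) → ℝ}
    {f' : EuclideanSpace ℝ (Fin n) →L[ℝ] ℝ} {l x : EuclideanSpace ℝ (Fin n)}
    (h : HasFDerivAt f f' x) (hl : ∀ z, f' z = inner ℝ l z) : gradient f x = l := by
  refine ext_inner_right ℝ fun z => ?_
  rw [inner_gradient, h.fderiv, hl]

theorem ContDiffAt.gradient {f : EuclideanSpace ℝ (Fin n) → ℝ} {x : EuclideanSpace ℝ (Fin n)}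
    (hf : ContDiffAt ℝ 2 f x) : ContDiffAt ℝ 1 (gradient f) x :=
  ((InnerProductSpace.toDual ℝ (EuclideanSpace ℝ (Fin n))).symm.contDiff (n := 1)).contDiffAt.comp
    x (hf.fderiv_right (m := 1) (by norm_num))

set_option maxHeartbeats 800000 in
/-- The pointwise estimate at a point where the control function
`|∇v|^(2a) e^(sv) - A |∇v|²` is touched from above by a positive `C²` function. -/
theorem control_estimate_of_touching (hn : 1 ≤ n) {a s A : ℝ} (ha : 1 < a)
    (hA : A * (a - 1) = 2 * n * a * s) {v Θ : EuclideanSpace ℝ (Fin n) → ℝ}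
    {y : EuclideanSpace ℝ (Fin n)} (hv : ContDiffAt ℝ 2 v y) (hΘ : ContDiffAt ℝ 2 Θ y)
    (heqn : ∀ᶠ x in 𝓝 y, elaplacian v x
      = -(‖gradient v x‖ ^ 2 + (‖gradient v x‖ ^ 2) ^ a * Real.exp (s * v x)))
    (hle : ∀ᶠ x in 𝓝 y,
      (‖gradient v x‖ ^ 2) ^ a * Real.exp (s * v x) - A * ‖gradient v x‖ ^ 2 ≤ Θ x)
    (heq : (‖gradient v y‖ ^ 2) ^ a * Real.exp (s * v y) - A * ‖gradient v y‖ ^ 2 = Θ y)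
    (hpos : 0 < Θ y) :
    (‖gradient v y‖ ^ 2) ^ a * Real.exp (s * v y) + ‖gradient v y‖ ^ 2
      ≤ 4 * n ^ 2 * a ^ 2 * (‖gradient Θ y‖ ^ 2 / Θ y ^ 2)
        + 2 * n * (elaplacian Θ y / Θ y) := by
  set w : EuclideanSpace ℝ (Fin n) → ℝ := fun x => ‖gradient v x‖ ^ 2 with hw
  have hwC : ContDiffAt ℝ 1 w y := hv.gradient.norm_sq ℝ
  have hw0 : 0 < w y := by
    rcases (sq_nonneg ‖gradient v y‖).eq_or_lt with h | h
    · rw [← h, Real.zero_rpow (by linarith)] at heq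
      simp only [zero_mul, mul_zero, sub_zero] at heq
      exact absurd heq hpos.ne
    · exact h
  set f₀ : ℝ := w y ^ a * Real.exp (s * v y) with hf₀
  have hf₀pos : 0 < f₀ := by positivity
  change f₀ - A * w y = Θ y at heq
  have hDw : HasFDerivAt w (fderiv ℝ w y) y :=
    (hwC.differentiableAt (by simp)).hasFDerivAt
  have hDv : HasFDerivAt v (fderiv ℝ v y) y := (hv.differentiableAt (by simp)).hasFDerivAt
  obtain ⟨l, hDwl⟩ : ∃ l : EuclideanSpace ℝ (Fin n),
      ∀ z, fderiv ℝ w y z = w y * inner ℝ l z := by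
    refine ⟨(w y)⁻¹ • gradient w y, fun z => ?_⟩
    rw [real_inner_smul_left, inner_gradient, mul_inv_cancel_left₀ hw0.ne']
  set N : EuclideanSpace ℝ (Fin n) → ℝ := fun x => inner ℝ l (x - y) with hN
  have hND : ∀ x, HasFDerivAt N (innerSL ℝ l) x := fun x =>
    (innerSL ℝ l).hasFDerivAt.comp x ((hasFDerivAt_id x).sub_const y)
  have hNC : ContDiffAt ℝ 2 N y := contDiffAt_const.inner ℝ (contDiffAt_id.sub contDiffAt_const)
  have hN0 : N y = 0 := by simp [hN]
  have hNlap : elaplacian N y = 0 := by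
    rw [elaplacian_eq_of_hasFDerivAt (Eventually.of_forall hND) (hasFDerivAt_const _ y)]
    simp
  have hNgrad : gradient N y = l := gradient_eq_of_hasFDerivAt_inner (hND y) fun z => rfl
  set m : EuclideanSpace ℝ (Fin n) → ℝ := fun x => a * N x + s * v x with hm
  have hmC : ContDiffAt ℝ 2 m y := by fun_prop
  have hmD : HasFDerivAt m (a • innerSL ℝ l + s • fderiv ℝ v y) y :=
    ((hND y).const_mul a).add (hDv.const_mul s)
  have hmgrad : gradient m y = a • l + s • gradient v y :=
    gradient_eq_of_hasFDerivAt_inner hmD fun z => by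
      rw [inner_add_left, real_inner_smul_left, real_inner_smul_left, inner_gradient]
      simp only [add_apply, smul_apply, innerSL_apply_apply, smul_eq_mul]
  have hmlap : elaplacian m y = s * elaplacian v y := by
    rw [hm, elaplacian_add (contDiffAt_const.mul hNC) (contDiffAt_const.mul hv),
      elaplacian_const_mul _ hNC, elaplacian_const_mul _ hv, hNlap]
    ring
  have hmy : w y ^ a * Real.exp (m y) = f₀ := by simp [hm, hN0, hf₀]
  have hexp : ∀ {h : EuclideanSpace ℝ (Fin n) → ℝ}, ContDiffAt ℝ 2 h y →
      elaplacian (fun x => Real.exp (h x)) y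
        = Real.exp (h y) * (elaplacian h y + ‖gradient h y‖ ^ 2) := fun {h} hh => by
    rw [elaplacian_comp hh (Eventually.of_forall fun t => Real.hasDerivAt_exp t)
      (Real.hasDerivAt_exp _)]
    ring
  -- the comparison functions
  set W : EuclideanSpace ℝ (Fin n) → ℝ := fun x => w y * Real.exp (N x) with hW
  set f₁ : EuclideanSpace ℝ (Fin n) → ℝ := fun x => w y ^ a * Real.exp (m x) with hf₁
  set P : EuclideanSpace ℝ (Fin n) → ℝ := fun x => a * f₁ x - A * W x with hP
  set K : EuclideanSpace ℝ (Fin n) → ℝ := fun x => f₁ x - A * W x - Θ x with hK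
  have hWC : ContDiffAt ℝ 2 W y := by fun_prop
  have hf₁C : ContDiffAt ℝ 2 f₁ y := by fun_prop
  have hPC : ContDiffAt ℝ 2 P y := by fun_prop
  have hKC : ContDiffAt ℝ 2 K y := by fun_prop
  have hWy : W y = w y := by simp [hW, hN0]
  have hPy : P y = a * f₀ - A * w y := by simp only [hP, hWy]; rw [← hmy]
  have hKy : K y = 0 := by
    have : f₁ y = f₀ := hmy
    simp only [hK, this, hWy]
    linarith
  have hPpos : 0 < P y := by
    rw [hPy]
    nlinarith
  have hWpos : ∀ x, 0 < W x := fun x => by positivity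
  set ψ : EuclideanSpace ℝ (Fin n) → ℝ := fun x => W x - W x / P x * K x with hψ
  have hWPC : ContDiffAt ℝ 2 (fun x => W x / P x) y := hWC.div hPC hPpos.ne'
  have hψC : ContDiffAt ℝ 2 ψ y := hWC.sub (hWPC.mul hKC)
  have hwψ : ∀ᶠ x in 𝓝 y, w x ≤ ψ x := by
    filter_upwards [hle, hPC.continuousAt.eventually (lt_mem_nhds hPpos),
      hwC.continuousAt.eventually (lt_mem_nhds hw0)] with x h1 h2 h3
    have hWx := hWpos x
    have hWa : W x ^ a * Real.exp (s * v x) = f₁ x := by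
      simp only [hW, hf₁, hm]
      rw [Real.mul_rpow hw0.le (Real.exp_pos _).le, ← Real.exp_mul, Real.exp_add]
      ring_nf
    have h4 : 1 + a * (w x / W x - 1) ≤ (w x / W x) ^ a := by
      have := one_add_mul_self_le_rpow_one_add (s := w x / W x - 1) (p := a)
        (by have := div_pos h3 hWx; linarith) ha.le
      simpa using this
    have h5 : f₁ x * (1 + a * (w x / W x - 1)) ≤ w x ^ a * Real.exp (s * v x) := by
      have h6 : w x ^ a = W x ^ a * (w x / W x) ^ a := by
        rw [← Real.mul_rpow hWx.le (by positivity), mul_div_cancel₀ _ hWx.ne']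
      have h7 : 0 ≤ f₁ x := by positivity
      calc f₁ x * (1 + a * (w x / W x - 1)) ≤ f₁ x * (w x / W x) ^ a := by gcongr
        _ = w x ^ a * Real.exp (s * v x) := by rw [h6, ← hWa]; ring
    have h7 : w x = W x * (w x / W x) := (mul_div_cancel₀ _ hWx.ne').symm
    have h8 : (w x / W x - 1) * P x ≤ -K x := by
      have h9 : A * w x = A * W x * (w x / W x) := by rw [mul_assoc, ← h7]
      change w x ^ a * Real.exp (s * v x) - A * w x ≤ Θ x at h1
      simp only [hP, hK]
      linarith
    rw [← le_div_iff₀ h2] at h8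
    have h10 : W x * (w x / W x - 1) ≤ W x * (-K x / P x) := by gcongr
    have h11 : ψ x = W x + W x * (-K x / P x) := by simp only [hψ]; ring
    rw [h11]
    linarith
  have hwψy : w y = ψ y := by simp [hψ, hKy, hWy]
  -- the first order condition
  have hDW : HasFDerivAt W (w y • innerSL ℝ l) y := by
    have := ((hND y).exp).const_mul (w y)
    simpa [hN0] using this
  have hDK : HasFDerivAt K (fderiv ℝ K y) y := (hKC.differentiableAt (by simp)).hasFDerivAt
  have hK' : fderiv ℝ K y = 0 := by
    have h1 : HasFDerivAt (fun x => w x - ψ x) _ y :=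
      hDw.sub (hDW.sub ((hWPC.differentiableAt (by simp)).hasFDerivAt.mul hDK))
    have h2 : IsLocalMax (fun x => w x - ψ x) y := by
      filter_upwards [hwψ] with x hx
      linarith
    have h3 := h2.hasFDerivAt_eq_zero h1
    ext z
    have h4 := congrArg (fun L : EuclideanSpace ℝ (Fin n) →L[ℝ] ℝ => L z) h3
    simp only [sub_apply, smul_apply, hDwl, hKy, smul_eq_mul, zero_smul, add_zero,
      innerSL_apply_apply, zero_apply] at h4
    have h5 : W y / P y * fderiv ℝ K y z = 0 := by linarith
    simpa [hPpos.ne', (hWpos y).ne'] using h5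
  have hfirst : ∀ z, f₀ * (a * inner ℝ l z + s * fderiv ℝ v y z) - A * (w y * inner ℝ l z)
      - fderiv ℝ Θ y z = 0 := fun z => by
    have h1 : HasFDerivAt K _ y := (((hmD.exp).const_mul (w y ^ a)).sub (hDW.const_mul A)).sub
      (hΘ.differentiableAt (by simp)).hasFDerivAt
    have h2 := congrArg (fun L : EuclideanSpace ℝ (Fin n) →L[ℝ] ℝ => L z) (h1.fderiv.symm.trans hK')
    simp only [sub_apply, add_apply, smul_apply, smul_eq_mul, innerSL_apply_apply,
      zero_apply] at h2
    rw [← h2, ← hmy]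
    ring
  -- the second order condition
  have hψlap : elaplacian ψ y = w y * ‖l‖ ^ 2 - w y / P y * (f₀ * (s * elaplacian v y
      + ‖a • l + s • gradient v y‖ ^ 2) - A * (w y * ‖l‖ ^ 2) - elaplacian Θ y) := by
    have hWlap : elaplacian W y = w y * ‖l‖ ^ 2 := by
      rw [hW, elaplacian_const_mul _ hNC.exp, hexp hNC, hN0, hNlap, hNgrad]
      simp
    have hf₁lap : elaplacian f₁ y
        = f₀ * (s * elaplacian v y + ‖a • l + s • gradient v y‖ ^ 2) := by
      rw [hf₁, elaplacian_const_mul _ hmC.exp, hexp hmC, hmlap, hmgrad, ← hmy]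
      ring
    rw [hψ, elaplacian_sub hWC (hWPC.mul hKC), elaplacian_mul_of_critical hWPC hKC hKy hK',
      hK, elaplacian_sub (hf₁C.sub (contDiffAt_const.mul hWC)) hΘ,
      elaplacian_sub hf₁C (contDiffAt_const.mul hWC), elaplacian_const_mul _ hWC, hWlap,
      hf₁lap, hWy]
  set g : EuclideanSpace ℝ (Fin n) → ℝ := fun x => -(w x + w x ^ a * Real.exp (s * v x)) with hg
  have hv1 : ContDiffAt ℝ 1 v y := hv.of_le (by norm_num)
  have hgC : ContDiffAt ℝ 1 g y := by
    have h1 : ContDiffAt ℝ 1 (fun x => w x ^ a) y := hwC.rpow_const_of_ne hw0.ne'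
    fun_prop
  have hgD : ∀ z, fderiv ℝ g y z
      = -(w y * inner ℝ l z + f₀ * (a * inner ℝ l z + s * fderiv ℝ v y z)) := fun z => by
    have h1 : HasFDerivAt g _ y := (hDw.add ((hDw.rpow_const (p := a) (Or.inl hw0.ne')).mul
      ((hDv.const_mul s).exp))).neg
    rw [h1.fderiv]
    simp only [neg_apply, add_apply, smul_apply, smul_eq_mul, hDwl]
    rw [Real.rpow_sub_one hw0.ne', hf₀]
    field_simp
    ring
  have hboch := bochner_of_touching hv (hgC.hasStrictFDerivAt (by simp)) heqn hψC hwψ hwψy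
  have hΔv : elaplacian v y = -(w y + f₀) := heqn.self_of_nhds
  have hvv : fderiv ℝ v y (gradient v y) = w y := by
    rw [← inner_gradient, real_inner_self_eq_norm_sq]
  rw [hψlap, hgD, hΔv, hvv] at hboch
  have hgy : g y = -(w y + f₀) := rfl
  rw [hgy, neg_sq] at hboch
  have hnorm : ∀ c d : ℝ, ‖c • l + d • gradient v y‖ ^ 2
      = c ^ 2 * ‖l‖ ^ 2 + 2 * (c * d) * inner ℝ l (gradient v y) + d ^ 2 * w y := fun c d => by
    rw [norm_add_sq_real, norm_smul, norm_smul, real_inner_smul_left, real_inner_smul_right,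
      mul_pow, mul_pow, Real.norm_eq_abs, Real.norm_eq_abs, sq_abs, sq_abs]
    ring
  rw [hnorm] at hboch
  have hscal := sq_add_le_of_bochner (n := n) (a := a) (s := s) (A := A) (f := f₀) (w := w y)
    (F := Θ y) (P := P y) (X := inner ℝ l (gradient v y)) (Y := ‖l‖ ^ 2)
    (Z := fderiv ℝ Θ y (gradient v y) / Θ y) (ε := ‖gradient Θ y‖ ^ 2 / Θ y ^ 2)
    (τ := elaplacian Θ y / Θ y) (by exact_mod_cast hn) ha hA hw0 hf₀pos heq.symm hpos hPy
    (by
      have := hfirst (gradient v y)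
      rw [hvv] at this
      rw [hPy, mul_div_cancel₀ _ hpos.ne']
      linarith)
    (by
      have := hnorm 1 (s / (a - 1))
      have h2 := sq_nonneg ‖(1 : ℝ) • l + (s / (a - 1)) • gradient v y‖
      linarith)
    (by
      rw [div_pow, div_mul_eq_mul_div]
      gcongr
      rw [← inner_gradient, ← sq_abs, ← mul_pow]
      gcongr
      exact abs_real_inner_le_norm _ _)
    (by
      rw [mul_div_cancel₀ _ hpos.ne']
      have h1 := mul_le_mul_of_nonneg_left hboch hPpos.le
      have h2 : ∀ b c : ℝ, P y * (c - w y / P y * b) = P y * c - w y * b := fun b c => by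
        field_simp
      rw [h2, hPy] at h1
      rw [hPy]
      linear_combination h1)
  have h1 : w y * (f₀ + w y) ≤ (f₀ + w y) ^ 2 := by
    rw [sq]
    gcongr
    linarith
  exact le_of_mul_le_mul_left (h1.trans hscal) hw0

theorem gradient_comp {f : EuclideanSpace ℝ (Fin n) → ℝ} {φ : ℝ → ℝ} {φ' : ℝ}
    {x : EuclideanSpace ℝ (Fin n)} (hφ : HasDerivAt φ φ' (f x)) (hf : DifferentiableAt ℝ f x) :
    gradient (fun y => φ (f y)) x = φ' • gradient f x :=
  gradient_eq_of_hasFDerivAt_inner (hφ.comp_hasFDerivAt x hf.hasFDerivAt) fun z => by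
    rw [real_inner_smul_left, inner_gradient]
    rfl

theorem gradient_sub_norm_sq (c : ℝ) (x₀ y : EuclideanSpace ℝ (Fin n)) :
    gradient (fun x => c - ‖x - x₀‖ ^ 2) y = (-2 : ℝ) • (y - x₀) :=
  gradient_eq_of_hasFDerivAt_inner (((hasFDerivAt_id y).sub_const x₀).norm_sq.const_sub c)
    fun z => by
      rw [real_inner_smul_left]
      simp [inner_sub_left]

theorem elaplacian_sub_norm_sq (c : ℝ) (x₀ y : EuclideanSpace ℝ (Fin n)) :
    elaplacian (fun x => c - ‖x - x₀‖ ^ 2) y = -(2 * n) := by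
  have h : elaplacian (fun _ : EuclideanSpace ℝ (Fin n) => c) y = 0 := by simp [elaplacian]
  have h' : ContDiffAt ℝ 2 (fun x => ‖x - x₀‖ ^ 2) y :=
    (contDiffAt_id.sub contDiffAt_const).norm_sq ℝ
  rw [elaplacian_sub contDiffAt_const h', h,
    elaplacian_norm_sq_affine (φ := fun x => x - x₀) y
      fun x => (hasFDerivAt_id x).sub_const x₀]
  simp

/-- The control function, localized by the squared distance to the boundary of a ball. -/
theorem localized_control_estimate (hn : 1 ≤ n) {a s A ρ : ℝ} (ha : 1 < a)
    (hA : A * (a - 1) = 2 * n * a * s) (hρ : 0 < ρ) {v : EuclideanSpace ℝ (Fin n) → ℝ}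
    {x₀ : EuclideanSpace ℝ (Fin n)} (hv : ∀ x ∈ Metric.closedBall x₀ ρ, ContDiffAt ℝ 2 v x)
    (heqn : ∀ x ∈ Metric.ball x₀ ρ, elaplacian v x
      = -(‖gradient v x‖ ^ 2 + (‖gradient v x‖ ^ 2) ^ a * Real.exp (s * v x))) :
    ∀ x ∈ Metric.ball x₀ ρ, (ρ ^ 2 - ‖x - x₀‖ ^ 2) ^ 2
        * ((‖gradient v x‖ ^ 2) ^ a * Real.exp (s * v x) - A * ‖gradient v x‖ ^ 2)
      ≤ (1 + |A|) * (64 * n ^ 2 * a ^ 2 + 2 * n * (4 * n + 24)) * ρ ^ 2 := by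
  set F : EuclideanSpace ℝ (Fin n) → ℝ := fun x =>
    (‖gradient v x‖ ^ 2) ^ a * Real.exp (s * v x) - A * ‖gradient v x‖ ^ 2 with hF
  set d : EuclideanSpace ℝ (Fin n) → ℝ := fun x => ρ ^ 2 - ‖x - x₀‖ ^ 2 with hd
  have hdC : ∀ x, ContDiffAt ℝ 2 d x := fun x =>
    contDiffAt_const.sub ((contDiffAt_id.sub contDiffAt_const).norm_sq ℝ)
  have hFC : ∀ x ∈ Metric.closedBall x₀ ρ, ContinuousAt F x := fun x hx => by
    have h1 : ContinuousAt (fun x => ‖gradient v x‖ ^ 2) x :=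
      (hv x hx).gradient.continuousAt.norm.pow 2
    have h2 := h1.rpow_const (p := a) (Or.inr (by linarith))
    have h3 := (hv x hx).continuousAt
    fun_prop
  obtain ⟨y, hy, hymax⟩ := (isCompact_closedBall x₀ ρ).exists_isMaxOn
    ⟨x₀, Metric.mem_closedBall_self hρ.le⟩ (f := fun x => d x ^ 2 * F x)
    fun x hx => (((hdC x).continuousAt.pow 2).mul (hFC x hx)).continuousWithinAt
  intro x hx
  have hxy : d x ^ 2 * F x ≤ d y ^ 2 * F y := hymax (Metric.ball_subset_closedBall hx)
  refine hxy.trans ?_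
  rcases le_or_gt (d y ^ 2 * F y) 0 with h0 | h0
  · exact h0.trans (by positivity)
  have hdy0 : d y ≠ 0 := fun h => by simp [h] at h0
  have hyρ : ‖y - x₀‖ ≤ ρ := mem_closedBall_iff_norm.mp hy
  have hdy : 0 < d y := by
    refine lt_of_le_of_ne ?_ hdy0.symm
    have : ‖y - x₀‖ ^ 2 ≤ ρ ^ 2 := by gcongr
    simp only [hd]
    linarith
  have hyball : y ∈ Metric.ball x₀ ρ := by
    rw [mem_ball_iff_norm]
    have : ‖y - x₀‖ ^ 2 < ρ ^ 2 := by simp only [hd] at hdy; linarith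
    exact lt_of_pow_lt_pow_left₀ 2 hρ.le this
  obtain ⟨c, hc⟩ : ∃ c, c = d y ^ 2 * F y := ⟨_, rfl⟩
  rw [← hc] at h0 ⊢
  have hφ : ∀ t : ℝ, t ≠ 0 → HasDerivAt (fun t : ℝ => c * (t ^ 2)⁻¹) (-(2 * c) * (t ^ 3)⁻¹) t :=
    fun t ht => by
      refine (((hasDerivAt_pow 2 t).inv (pow_ne_zero 2 ht)).const_mul c).congr_deriv ?_
      field_simp
      push_cast
      ring
  have hφ' : HasDerivAt (fun t : ℝ => -(2 * c) * (t ^ 3)⁻¹) (6 * c * (d y ^ 4)⁻¹) (d y) := by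
    refine (((hasDerivAt_pow 3 (d y)).inv (pow_ne_zero 3 hdy0)).const_mul (-(2 * c))).congr_deriv ?_
    field_simp
    push_cast
    ring
  set Θ : EuclideanSpace ℝ (Fin n) → ℝ := fun x => c * (d x ^ 2)⁻¹ with hΘ
  have hΘC : ContDiffAt ℝ 2 Θ y :=
    contDiffAt_const.mul (((hdC y).pow 2).inv (pow_ne_zero 2 hdy0))
  have hΘy : F y = Θ y := by
    simp only [hΘ, hc]
    field_simp
  have hΘpos : 0 < Θ y := by positivity
  have hΘgrad : ‖gradient Θ y‖ ^ 2 / Θ y ^ 2 = 16 * ‖y - x₀‖ ^ 2 / d y ^ 2 := by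
    rw [hΘ, gradient_comp (hφ _ hdy0) ((hdC y).differentiableAt (by simp)), hd,
      gradient_sub_norm_sq, norm_smul, norm_smul, mul_pow, mul_pow, Real.norm_eq_abs,
      Real.norm_eq_abs, sq_abs, sq_abs]
    change (-(2 * c) * (d y ^ 3)⁻¹) ^ 2 * ((-2) ^ 2 * ‖y - x₀‖ ^ 2) / (c * (d y ^ 2)⁻¹) ^ 2
      = 16 * ‖y - x₀‖ ^ 2 / d y ^ 2
    field_simp
    ring
  have hΘlap : elaplacian Θ y / Θ y = (4 * n * d y + 24 * ‖y - x₀‖ ^ 2) / d y ^ 2 := by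
    have h1 : ‖gradient d y‖ ^ 2 = 4 * ‖y - x₀‖ ^ 2 := by
      rw [hd, gradient_sub_norm_sq, norm_smul, mul_pow, Real.norm_eq_abs, sq_abs]
      norm_num
    have h2 : elaplacian d y = -(2 * n) := elaplacian_sub_norm_sq _ _ _
    rw [hΘ, elaplacian_comp (φ := fun t => c * (t ^ 2)⁻¹) (hdC y)
      (by filter_upwards [isOpen_ne.mem_nhds hdy0] with t ht using hφ t ht) hφ', h1, h2]
    field_simp
    ring
  have hle : ∀ᶠ x in 𝓝 y, F x ≤ Θ x := by
    filter_upwards [Metric.isOpen_ball.mem_nhds hyball,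
      (hdC y).continuousAt.eventually (lt_mem_nhds hdy)] with z hz hdz
    have h1 : d z ^ 2 * F z ≤ c := hc ▸ hymax (Metric.ball_subset_closedBall hz)
    simp only [hΘ]
    rw [← div_eq_mul_inv, le_div_iff₀ (by positivity), mul_comm]
    exact h1
  have key := control_estimate_of_touching hn ha hA (hv y hy) hΘC
    (by filter_upwards [Metric.isOpen_ball.mem_nhds hyball] with z hz using heqn z hz)
    hle hΘy hΘpos
  rw [hΘgrad, hΘlap] at key
  have hnorm : ‖y - x₀‖ ^ 2 ≤ ρ ^ 2 := by gcongr
  have hdρ : d y ≤ ρ ^ 2 := by simp only [hd]; linarith [sq_nonneg ‖y - x₀‖]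
  have hFle : F y ≤ (1 + |A|) * ((‖gradient v y‖ ^ 2) ^ a * Real.exp (s * v y)
      + ‖gradient v y‖ ^ 2) := by
    have h1 : 0 ≤ (‖gradient v y‖ ^ 2) ^ a * Real.exp (s * v y) := by positivity
    have h2 : 0 ≤ ‖gradient v y‖ ^ 2 := by positivity
    have h3 := mul_le_mul_of_nonneg_right (neg_abs_le A) h2
    have h4 := mul_nonneg (abs_nonneg A) h1
    simp only [hF]
    linear_combination h3 + h4 + h2
  have h5 : 4 * n ^ 2 * a ^ 2 * (16 * ‖y - x₀‖ ^ 2 / d y ^ 2)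
      + 2 * n * ((4 * n * d y + 24 * ‖y - x₀‖ ^ 2) / d y ^ 2)
      ≤ 4 * n ^ 2 * a ^ 2 * (16 * ρ ^ 2 / d y ^ 2)
        + 2 * n * ((4 * n * ρ ^ 2 + 24 * ρ ^ 2) / d y ^ 2) := by gcongr
  calc c = d y ^ 2 * F y := hc
    _ ≤ d y ^ 2 * ((1 + |A|) * (4 * n ^ 2 * a ^ 2 * (16 * ρ ^ 2 / d y ^ 2)
        + 2 * n * ((4 * n * ρ ^ 2 + 24 * ρ ^ 2) / d y ^ 2))) := by
      gcongr
      exact hFle.trans (mul_le_mul_of_nonneg_left (key.trans h5) (by positivity))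
    _ = _ := by
      field_simp
      ring

end Laplacian

/-- **Theorem 2.4 (Euclidean case, strong control lemma for `q > 2`).** For `n ≥ 2`,
`q > 2` and `p ∈ ℝ`, there is `C = C(n,p,q) > 0` such that every positive classical
solution of `Δu + |∇u|^q u^p = 0` on `B(x₀, 2R)` satisfies
`sup_(B(x₀,R)) (|∇u|^q u^(p−1) − (2nq(p+q−1)/(q−2)) |∇u|²/u²) ≤ C / R²`. -/
theorem strong_control_estimate (n : ℕ) (hn : 2 ≤ n) (p q : ℝ) (hq : 2 < q) :
    ∃ C > (0 : ℝ), ∀ (x₀ : EuclideanSpace ℝ (Fin n)) (R : ℝ), 0 < R →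
      ∀ u : EuclideanSpace ℝ (Fin n) → ℝ,
        ContDiffOn ℝ 2 u (Metric.ball x₀ (2 * R)) →
        (∀ x ∈ Metric.ball x₀ (2 * R), 0 < u x) →
        (∀ x ∈ Metric.ball x₀ (2 * R),
          elaplacian u x + ‖gradient u x‖ ^ q * u x ^ p = 0) →
        ∀ x ∈ Metric.ball x₀ R,
          ‖gradient u x‖ ^ q * u x ^ (p - 1)
            - (2 * (n : ℝ) * q * (p + q - 1) / (q - 2)) * (‖gradient u x‖ ^ 2 / u x ^ 2)
            ≤ C / R ^ 2 := by
  set A : ℝ := 2 * (n : ℝ) * q * (p + q - 1) / (q - 2) with hA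
  set C₀ : ℝ := (1 + |A|) * (64 * n ^ 2 * (q / 2) ^ 2 + 2 * n * (4 * n + 24)) with hC₀
  have hn0 : (0 : ℝ) < n := by exact_mod_cast (by lia : 0 < n)
  have hC₀pos : 0 < C₀ := by positivity
  refine ⟨2 * C₀, by positivity, fun x₀ R hR u hu hupos hequ x hx => ?_⟩
  have hball : Metric.closedBall x₀ (3 / 2 * R) ⊆ Metric.ball x₀ (2 * R) :=
    Metric.closedBall_subset_ball (by linarith)
  have huC : ∀ z ∈ Metric.ball x₀ (2 * R), ContDiffAt ℝ 2 u z := fun z hz =>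
    hu.contDiffAt (Metric.isOpen_ball.mem_nhds hz)
  obtain ⟨v, hv⟩ : ∃ v : EuclideanSpace ℝ (Fin n) → ℝ, v = fun z => Real.log (u z) := ⟨_, rfl⟩
  have hvC : ∀ z ∈ Metric.ball x₀ (2 * R), ContDiffAt ℝ 2 v z := fun z hz =>
    hv ▸ (huC z hz).log (hupos z hz).ne'
  have hgrad : ∀ z ∈ Metric.ball x₀ (2 * R),
      ‖gradient v z‖ ^ 2 = ‖gradient u z‖ ^ 2 / u z ^ 2 := fun z hz => by
    rw [hv, gradient_comp (Real.hasDerivAt_log (hupos z hz).ne')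
      ((huC z hz).differentiableAt (by simp)), norm_smul, mul_pow, Real.norm_eq_abs, sq_abs,
      inv_pow, div_eq_inv_mul]
  have hcontrol : ∀ z ∈ Metric.ball x₀ (2 * R),
      (‖gradient v z‖ ^ 2) ^ (q / 2) * Real.exp ((p + q - 1) * v z)
        = ‖gradient u z‖ ^ q * u z ^ (p - 1) := fun z hz => by
    have h0 := hupos z hz
    have h1 : ((‖gradient u z‖ / u z) ^ 2) ^ (q / 2) = (‖gradient u z‖ / u z) ^ q := by
      rw [← Real.rpow_natCast, ← Real.rpow_mul (by positivity)]
      congr 1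
      push_cast
      ring
    have h2 : u z ^ (p + q - 1) = u z ^ (p - 1) * u z ^ q := by
      rw [← Real.rpow_add h0]
      ring_nf
    rw [hgrad z hz, ← div_pow, h1, Real.div_rpow (norm_nonneg _) h0.le, hv, mul_comm (p + q - 1),
      ← Real.rpow_def_of_pos h0, h2]
    have := Real.rpow_pos_of_pos h0 q
    field_simp
  have hlap : ∀ z ∈ Metric.ball x₀ (2 * R), elaplacian v z
      = -(‖gradient v z‖ ^ 2
        + (‖gradient v z‖ ^ 2) ^ (q / 2) * Real.exp ((p + q - 1) * v z)) := fun z hz => by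
    have h0 := hupos z hz
    have h1 : elaplacian u z = -(‖gradient u z‖ ^ q * u z ^ p) := by linarith [hequ z hz]
    have h2 : u z ^ (p - 1) = u z ^ p / u z := Real.rpow_sub_one h0.ne' p
    rw [hcontrol z hz, hgrad z hz, hv, elaplacian_comp (huC z hz)
      (by filter_upwards [isOpen_ne.mem_nhds h0.ne'] with t ht using Real.hasDerivAt_log ht)
      (hasDerivAt_inv h0.ne'), h1, h2]
    field_simp
    ring
  have hxR : ‖x - x₀‖ < R := mem_ball_iff_norm.mp hx
  have hx2 : x ∈ Metric.ball x₀ (2 * R) := Metric.ball_subset_ball (by linarith) hx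
  have key := localized_control_estimate (by lia : 1 ≤ n) (a := q / 2) (s := p + q - 1) (A := A)
    (ρ := 3 / 2 * R) (by linarith)
    (by
      have : q - 2 ≠ 0 := by linarith
      rw [hA]
      field_simp)
    (by positivity) (fun z hz => hvC z (hball hz))
    (fun z hz => hlap z (hball (Metric.ball_subset_closedBall hz))) x
    (Metric.ball_subset_ball (by linarith) hx)
  rw [hcontrol x hx2, hgrad x hx2] at key
  generalize ‖gradient u x‖ ^ q * u x ^ (p - 1) - A * (‖gradient u x‖ ^ 2 / u x ^ 2) = F at key ⊢
  rcases le_or_gt F 0 with hF | hF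
  · exact hF.trans (by positivity)
  have hdist : 5 / 4 * R ^ 2 ≤ (3 / 2 * R) ^ 2 - ‖x - x₀‖ ^ 2 := by
    have : ‖x - x₀‖ ^ 2 ≤ R ^ 2 := by gcongr
    linear_combination this
  have h1 : (5 / 4 * R ^ 2) ^ 2 * F ≤ C₀ * (3 / 2 * R) ^ 2 := by
    refine le_trans ?_ key
    gcongr
  have h2 : R ^ 2 * (25 / 16 * (R ^ 2 * F)) ≤ R ^ 2 * (9 / 4 * C₀) := by linear_combination h1
  have h3 := le_of_mul_le_mul_left h2 (by positivity)
  rw [le_div_iff₀ (by positivity)]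
  linarith
end

section
/- Let q ∈ [0,2) and p ∈ ℝ. Then there exist β = β(p,q) ≥ 0 and C = C(p,q) > 0 such that for every x₀ ∈ ℝ², every R > 0, every positive classical solution u of Δu + |∇u|^q u^p = 0 on the ball B(x₀, 2R) ⊂ ℝ², and every r with 0 < r ≤ R, one has sup_{x ∈ B(x₀,R)} u(x)^{−β} |∇u(x)|²/u(x)² ≤ (C/(R·r)) · ( min_{y ∈ ∂B(x₀,r)} u(y) )^{−β}, where ∂B(x₀,r) is the circle of center x₀ and radius r. -/
open scoped BigOperators

open Filter Topology Complex in
theorem hasDerivAt_integral_circleMap {L : ℂ → ℂ} {L' : ℂ → ℂ →L[ℝ] ℂ} {z₀ : ℂ} {ρ K r : ℝ}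
    (hL : ∀ z ∈ Metric.ball z₀ ρ, HasFDerivAt L (L' z) z)
    (hc : ∀ z ∈ Metric.ball z₀ ρ, ContinuousAt L' z)
    (hK : ∀ z ∈ Metric.ball z₀ ρ, ‖L' z‖ ≤ K) (hr : |r| < ρ) :
    HasDerivAt (fun s : ℝ => ∫ θ in (0 : ℝ)..2 * Real.pi, L (circleMap z₀ s θ))
      (∫ θ in (0 : ℝ)..2 * Real.pi, L' (circleMap z₀ r θ) (exp (θ * I))) r := by
  have hmem : ∀ s : ℝ, |s| < ρ → ∀ θ : ℝ, circleMap z₀ s θ ∈ Metric.ball z₀ ρ := by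
    intro s hs θ
    simpa [circleMap, dist_eq_norm] using hs
  have hnhds : {s : ℝ | |s| < ρ} ∈ 𝓝 r :=
    (isOpen_lt continuous_abs continuous_const).mem_nhds hr
  have hcont : ∀ s : ℝ, |s| < ρ → Continuous fun θ : ℝ => L (circleMap z₀ s θ) := fun s hs =>
    continuous_iff_continuousAt.2 fun θ =>
      ContinuousAt.comp' (hL _ (hmem s hs θ)).continuousAt (continuous_circleMap z₀ s).continuousAt
  have hcont' : Continuous fun θ : ℝ => L' (circleMap z₀ r θ) (exp (θ * I)) := by
    have h1 : Continuous fun θ : ℝ => L' (circleMap z₀ r θ) :=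
      continuous_iff_continuousAt.2 fun θ =>
        ContinuousAt.comp' (hc _ (hmem r hr θ)) (continuous_circleMap z₀ r).continuousAt
    exact h1.clm_apply (by fun_prop)
  refine (intervalIntegral.hasDerivAt_integral_of_dominated_loc_of_deriv_le (𝕜 := ℝ)
    (F' := fun s θ => L' (circleMap z₀ s θ) (exp (θ * I))) (bound := fun _ => K)
    hnhds ?_ ((hcont r hr).intervalIntegrable _ _) hcont'.aestronglyMeasurable ?_ (by simp) ?_).2
  · filter_upwards [hnhds] with s hs using (hcont s hs).aestronglyMeasurable
  · refine Eventually.of_forall fun θ _ s hs => ?_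
    refine (ContinuousLinearMap.le_opNorm _ _).trans ?_
    simpa [norm_exp_ofReal_mul_I] using hK _ (hmem s hs θ)
  · refine Eventually.of_forall fun θ _ s hs => ?_
    have h1 : HasDerivAt (fun s : ℝ => circleMap z₀ s θ) (exp (θ * I)) s := by
      simpa [circleMap] using ((ofRealCLM.hasDerivAt (x := s)).mul_const (exp (θ * I))).const_add z₀
    exact (hL _ (hmem s hs θ)).comp_hasDerivAt s h1

open Complex in
theorem integral_fderiv_circleMap_tangent {L : ℂ → ℂ} {L' : ℂ → ℂ →L[ℝ] ℂ} {z₀ : ℂ} {ρ r : ℝ}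
    (hL : ∀ z ∈ Metric.ball z₀ ρ, HasFDerivAt L (L' z) z)
    (hc : ∀ z ∈ Metric.ball z₀ ρ, ContinuousAt L' z) (hr0 : r ≠ 0) (hr : |r| < ρ) :
    ∫ θ in (0 : ℝ)..2 * Real.pi, L' (circleMap z₀ r θ) (I * exp (θ * I)) = 0 := by
  have hmem : ∀ θ : ℝ, circleMap z₀ r θ ∈ Metric.ball z₀ ρ := by
    intro θ
    simpa [circleMap, dist_eq_norm] using hr
  have hcont : Continuous fun θ : ℝ => L' (circleMap z₀ r θ) (I * exp (θ * I)) := by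
    have h1 : Continuous fun θ : ℝ => L' (circleMap z₀ r θ) :=
      continuous_iff_continuousAt.2 fun θ =>
        ContinuousAt.comp' (hc _ (hmem θ)) (continuous_circleMap z₀ r).continuousAt
    exact h1.clm_apply (by fun_prop)
  have hd : ∀ θ : ℝ, HasDerivAt (fun θ => (r : ℂ)⁻¹ * L (circleMap z₀ r θ))
      (L' (circleMap z₀ r θ) (I * exp (θ * I))) θ := by
    intro θ
    have h := ((hL _ (hmem θ)).comp_hasDerivAt θ (hasDerivAt_circleMap z₀ r θ)).const_mul (r : ℂ)⁻¹
    have h2 : circleMap 0 r θ * I = r • (I * exp (θ * I)) := by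
      simp [circleMap]; ring
    rwa [h2, map_smul, real_smul, inv_mul_cancel_left₀ (ofReal_ne_zero.2 hr0)] at h
  rw [intervalIntegral.integral_eq_sub_of_hasDerivAt (fun θ _ => hd θ)
    (hcont.intervalIntegrable _ _)]
  simp [circleMap]

open Complex in
theorem integral_exp_mul_clm_exp (T : ℂ →L[ℝ] ℂ) :
    ∫ θ in (0 : ℝ)..2 * Real.pi, exp (-(θ * I)) * T (exp (θ * I))
      = Real.pi * (T 1 - I * T I) := by
  have h : ∀ θ : ℝ, exp (-(θ * I)) * T (exp (θ * I))
      = (T 1 - I * T I) / 2 + (T 1 + I * T I) / 2 * exp ((-2 * I) * θ) := by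
    intro θ
    have e1 : exp (θ * I) = (Real.cos θ) • (1 : ℂ) + (Real.sin θ) • I := by
      rw [exp_mul_I]; simp
    have e2 : exp (-(θ * I)) = Real.cos θ - Real.sin θ * I := by
      rw [← neg_mul, exp_mul_I]; simp; ring
    have e3 : exp ((-2 * I) * θ) = exp (-(θ * I)) ^ 2 := by
      rw [← exp_nat_mul]; congr 1; push_cast; ring
    rw [e3, e1, e2, map_add, map_smul, map_smul, real_smul, real_smul]
    have h4 : (Real.sin θ : ℂ) ^ 2 = 1 - (Real.cos θ : ℂ) ^ 2 := by
      have := Real.sin_sq_add_cos_sq θ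
      rw [eq_sub_iff_add_eq]; exact_mod_cast this
    have h5 := I_sq
    linear_combination (norm := ring_nf) (T 1 + I * T I) / 2 * h4
    simp only [I_sq, h4, show I ^ 3 = -I by rw [pow_succ, I_sq]; ring]
    ring
  simp_rw [h]
  rw [intervalIntegral.integral_add (by simp) ((by fun_prop : Continuous _).intervalIntegrable _ _),
    intervalIntegral.integral_const_mul, integral_exp_mul_complex (by simp)]
  have : exp (-2 * I * ((2 * Real.pi : ℝ) : ℂ)) = 1 := by
    have := exp_int_mul_two_pi_mul_I (-2)
    rw [← this]; congr 1; push_cast; ring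
  rw [this]
  simp
  ring

open Filter Topology Complex in
theorem re_dbar_deriv_nonpos_of_isLocalMax {L H : ℂ → ℂ} {z₀ : ℂ}
    {H' : ℂ →L[ℝ] ℂ} (hL₀ : ContDiffAt ℝ 1 L z₀)
    (hH : ∀ᶠ z in 𝓝 z₀, fderiv ℝ L z 1 + I * fderiv ℝ L z I = H z) (hH' : HasFDerivAt H H' z₀)
    (hmax : IsLocalMax (fun z => (L z).re) z₀) : (H' 1 - I * H' I).re ≤ 0 := by
  by_contra! hpos
  have hev : ∀ᶠ z in 𝓝 z₀, ContDiffAt ℝ 1 L z := hL₀.eventually (by simp)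
  have hL : ∀ᶠ z in 𝓝 z₀, HasFDerivAt L (fderiv ℝ L z) z :=
    hev.mono fun z hz => (hz.differentiableAt one_ne_zero).hasFDerivAt
  have hc : ∀ᶠ z in 𝓝 z₀, ContinuousAt (fderiv ℝ L) z :=
    hev.mono fun z hz => hz.continuousAt_fderiv one_ne_zero
  generalize fderiv ℝ L = L' at hH hL hc
  set D := (H' 1 - I * H' I).re with hD
  have hbd : ∀ᶠ z in 𝓝 z₀, ‖L' z‖ ≤ ‖L' z₀‖ + 1 :=
    (hc.self_of_nhds.norm.eventually_le_const (by linarith))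
  have hlit := (hasFDerivAt_iff_isLittleO.1 hH').bound (show 0 < D / 4 by linarith)
  obtain ⟨ρ, hρ, hball⟩ := Metric.eventually_nhds_iff_ball.1
    (hL.and (hc.and (hH.and (hbd.and (hlit.and hmax)))))
  have hmem : ∀ s : ℝ, |s| < ρ → ∀ θ : ℝ, circleMap z₀ s θ ∈ Metric.ball z₀ ρ := by
    intro s hs θ
    simpa [circleMap, dist_eq_norm] using hs
  have hL1 := fun z hz => (hball z hz).1
  have hc1 := fun z hz => (hball z hz).2.1
  have hd : ∀ r : ℝ, |r| < ρ → HasDerivAt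
      (fun s : ℝ => (∫ θ in (0 : ℝ)..2 * Real.pi, L (circleMap z₀ s θ)).re)
      (∫ θ in (0 : ℝ)..2 * Real.pi, L' (circleMap z₀ r θ) (exp (θ * I))).re r := fun r hr =>
    reCLM.hasFDerivAt.comp_hasDerivAt r
      (hasDerivAt_integral_circleMap hL1 hc1 (fun z hz => (hball z hz).2.2.2.1) hr)
  have hcL' : ∀ r : ℝ, |r| < ρ → Continuous fun θ : ℝ => L' (circleMap z₀ r θ) := fun r hr =>
    continuous_iff_continuousAt.2 fun θ =>
      ContinuousAt.comp' (hc1 _ (hmem r hr θ)) (continuous_circleMap z₀ r).continuousAt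
  have hder : ∀ r : ℝ, 0 < r → r < ρ →
      0 < (∫ θ in (0 : ℝ)..2 * Real.pi, L' (circleMap z₀ r θ) (exp (θ * I))).re := by
    intro r hr hrρ
    have hr' : |r| < ρ := by rwa [abs_of_pos hr]
    have hci1 : Continuous fun θ : ℝ => L' (circleMap z₀ r θ) (exp (θ * I)) :=
      (hcL' r hr').clm_apply (by fun_prop)
    have hci2 : Continuous fun θ : ℝ => L' (circleMap z₀ r θ) (I * exp (θ * I)) :=
      (hcL' r hr').clm_apply (by fun_prop)
    have hcH : Continuous fun θ : ℝ => H (circleMap z₀ r θ) := by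
      have : (fun θ : ℝ => H (circleMap z₀ r θ)) = fun θ : ℝ =>
          L' (circleMap z₀ r θ) 1 + I * L' (circleMap z₀ r θ) I :=
        funext fun θ => ((hball _ (hmem r hr' θ)).2.2.1).symm
      rw [this]
      exact ((hcL' r hr').clm_apply continuous_const).add
        (continuous_const.mul ((hcL' r hr').clm_apply continuous_const))
    have hrot : ∀ θ : ℝ, exp (-(θ * I)) * H (circleMap z₀ r θ)
        = L' (circleMap z₀ r θ) (exp (θ * I)) + I * L' (circleMap z₀ r θ) (I * exp (θ * I)) := by
      intro θ
      rw [← (hball _ (hmem r hr' θ)).2.2.1]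
      generalize L' (circleMap z₀ r θ) = T
      have e1 : exp (θ * I) = (Real.cos θ) • (1 : ℂ) + (Real.sin θ) • I := by
        rw [exp_mul_I]; simp
      have e2 : exp (-(θ * I)) = Real.cos θ - Real.sin θ * I := by
        rw [← neg_mul, exp_mul_I]; simp; ring
      have e3 : I * exp (θ * I) = (Real.cos θ) • I + (-Real.sin θ) • (1 : ℂ) := by
        rw [exp_mul_I]
        simp
        linear_combination (Complex.sin θ) * I_sq
      rw [e3, e2, e1, map_add, map_smul, map_smul, real_smul, real_smul, map_add, map_smul,
        map_smul, real_smul, real_smul]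
      push_cast
      linear_combination - Complex.sin θ * T I * I_sq
    have hI0 : ∫ θ in (0 : ℝ)..2 * Real.pi, exp (-(θ * I)) = 0 := by
      have := integral_exp_mul_complex (a := 0) (b := 2 * Real.pi) (c := -I) (by simp)
      have h1 : exp (-(2 * Real.pi * I)) = 1 := by
        have := exp_int_mul_two_pi_mul_I (-1)
        rw [← this]; congr 1; push_cast; ring
      simpa [h1, mul_comm I] using this
    have hI1 : ∫ θ in (0 : ℝ)..2 * Real.pi, L' (circleMap z₀ r θ) (exp (θ * I))
        = ∫ θ in (0 : ℝ)..2 * Real.pi, exp (-(θ * I)) * H (circleMap z₀ r θ) := by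
      have hci3 : Continuous fun θ : ℝ => I * L' (circleMap z₀ r θ) (I * exp (θ * I)) :=
        continuous_const.mul hci2
      simp_rw [hrot]
      rw [intervalIntegral.integral_add (hci1.intervalIntegrable _ _)
        (hci3.intervalIntegrable _ _),
        intervalIntegral.integral_const_mul,
        integral_fderiv_circleMap_tangent hL1 hc1 hr.ne' hr']
      simp
    have hI2 : ∫ θ in (0 : ℝ)..2 * Real.pi, exp (-(θ * I)) *
          (H (circleMap z₀ r θ) - H z₀ - H' (circleMap z₀ r θ - z₀))
        = (∫ θ in (0 : ℝ)..2 * Real.pi, exp (-(θ * I)) * H (circleMap z₀ r θ))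
          - r * (Real.pi * (H' 1 - I * H' I)) := by
      have hpt : ∀ θ : ℝ, exp (-(θ * I)) *
          (H (circleMap z₀ r θ) - H z₀ - H' (circleMap z₀ r θ - z₀))
          = exp (-(θ * I)) * H (circleMap z₀ r θ) -
            (exp (-(θ * I)) * H z₀ + r * (exp (-(θ * I)) * H' (exp (θ * I)))) := by
        intro θ
        have : circleMap z₀ r θ - z₀ = r • exp (θ * I) := by simp [circleMap]
        rw [this, map_smul, real_smul]
        ring
      simp_rw [hpt]
      have c1 : Continuous fun θ : ℝ => exp (-(θ * I)) * H (circleMap z₀ r θ) :=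
        Continuous.mul (by fun_prop) hcH
      have c2 : Continuous fun θ : ℝ => exp (-(θ * I)) * H z₀ := by fun_prop
      have c3 : Continuous fun θ : ℝ => r * (exp (-(θ * I)) * H' (exp (θ * I))) := by fun_prop
      have c23 : Continuous fun θ : ℝ =>
          exp (-(θ * I)) * H z₀ + r * (exp (-(θ * I)) * H' (exp (θ * I))) := c2.add c3
      rw [intervalIntegral.integral_sub (c1.intervalIntegrable _ _)
          (c23.intervalIntegrable _ _),
        intervalIntegral.integral_add (c2.intervalIntegrable _ _) (c3.intervalIntegrable _ _),
        intervalIntegral.integral_mul_const, hI0, intervalIntegral.integral_const_mul,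
        integral_exp_mul_clm_exp]
      ring
    have hbound : ‖∫ θ in (0 : ℝ)..2 * Real.pi, exp (-(θ * I)) *
          (H (circleMap z₀ r θ) - H z₀ - H' (circleMap z₀ r θ - z₀))‖
        ≤ D / 4 * r * |2 * Real.pi - 0| := by
      refine intervalIntegral.norm_integral_le_of_norm_le_const fun θ _ => ?_
      have h1 := (hball _ (hmem r hr' θ)).2.2.2.2.1
      have h2 : ‖exp (-(θ * I))‖ = 1 := by
        simpa using norm_exp_ofReal_mul_I (-θ)
      rw [norm_mul, h2, one_mul]
      simpa [circleMap, abs_of_pos hr] using h1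
    rw [hI2, ← hI1, sub_zero, abs_of_pos (by positivity)] at hbound
    have h3 := (abs_re_le_norm _).trans hbound
    have h4 : ((r : ℂ) * (Real.pi * (H' 1 - I * H' I))).re = r * (Real.pi * D) := by
      rw [re_ofReal_mul, re_ofReal_mul]
    rw [sub_re, h4] at h3
    have h5 := (abs_le.1 h3).1
    have h6 : 0 < r * (Real.pi * D) := by positivity
    nlinarith
  have hmono : StrictMonoOn
      (fun s : ℝ => (∫ θ in (0 : ℝ)..2 * Real.pi, L (circleMap z₀ s θ)).re)
      (Set.Icc 0 (ρ / 2)) := by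
    refine strictMonoOn_of_deriv_pos (convex_Icc _ _) (fun s hs => ?_) fun s hs => ?_
    · exact (hd s (by rw [abs_of_nonneg hs.1]; linarith [hs.2])).continuousAt.continuousWithinAt
    · rw [interior_Icc] at hs
      rw [(hd s (by rw [abs_of_pos hs.1]; linarith [hs.2])).deriv]
      exact hder s hs.1 (by linarith [hs.2])
  have hlt := hmono (Set.left_mem_Icc.2 (by linarith)) (Set.right_mem_Icc.2 (by linarith))
    (by linarith : (0 : ℝ) < ρ / 2)
  have hρ2 : |ρ / 2| < ρ := by rw [abs_of_pos (by linarith)]; linarith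
  have hcl : Continuous fun θ : ℝ => L (circleMap z₀ (ρ / 2) θ) :=
    continuous_iff_continuousAt.2 fun θ => ContinuousAt.comp'
      (hL1 _ (hmem _ hρ2 θ)).continuousAt (continuous_circleMap z₀ _).continuousAt
  have hle : (∫ θ in (0 : ℝ)..2 * Real.pi, L (circleMap z₀ (ρ / 2) θ)).re
      ≤ 2 * Real.pi * (L z₀).re := by
    have h1 : (∫ θ in (0 : ℝ)..2 * Real.pi, L (circleMap z₀ (ρ / 2) θ)).re
        = ∫ θ in (0 : ℝ)..2 * Real.pi, (L (circleMap z₀ (ρ / 2) θ)).re :=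
      (reCLM.intervalIntegral_comp_comm (hcl.intervalIntegrable _ _)).symm
    have h2 := intervalIntegral.integral_mono_on (μ := MeasureTheory.volume)
      (by positivity : (0 : ℝ) ≤ 2 * Real.pi)
      ((continuous_re.comp hcl).intervalIntegrable _ _)
      ((continuous_const (y := (L z₀).re)).intervalIntegrable _ _)
      (fun θ _ => (hball _ (hmem _ hρ2 θ)).2.2.2.2.2)
    rw [h1]
    simpa using h2
  have h0 : (∫ θ in (0 : ℝ)..2 * Real.pi, L (circleMap z₀ 0 θ)).re = 2 * Real.pi * (L z₀).re := by
    simp [circleMap_zero_radius]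
  simp only [h0] at hlt
  linarith

open Filter Topology Complex in
theorem laplacian_nonpos_of_isLocalMax {φ a b : ℂ → ℝ} {z₀ : ℂ} {a' b' : ℂ →L[ℝ] ℝ}
    (hφ₀ : ContDiffAt ℝ 1 φ z₀)
    (hφ : ∀ᶠ z in 𝓝 z₀, HasFDerivAt φ (a z • reCLM + b z • imCLM) z)
    (ha : HasFDerivAt a a' z₀) (hb : HasFDerivAt b b' z₀)
    (hmax : IsLocalMax φ z₀) : a' 1 + b' I ≤ 0 := by
  have hH' : HasFDerivAt (fun z => (a z : ℂ) + I * b z)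
      (ofRealCLM ∘L a' + I • (ofRealCLM ∘L b')) z₀ :=
    (ofRealCLM.hasFDerivAt.comp z₀ ha).add ((ofRealCLM.hasFDerivAt.comp z₀ hb).const_mul I)
  have h := re_dbar_deriv_nonpos_of_isLocalMax (L := fun z => (φ z : ℂ))
    (ofRealCLM.contDiff.contDiffAt.comp z₀ hφ₀) (hφ.mono fun z hz => ?_) hH' (by simpa using hmax)
  · simpa using h
  · have : HasFDerivAt (fun z => (φ z : ℂ)) (ofRealCLM ∘L (a z • reCLM + b z • imCLM)) z :=
      ofRealCLM.hasFDerivAt.comp z hz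
    rw [this.fderiv]
    simp

/-- The pointwise inequality behind the gradient estimate: `N = a² + b²` is the squared gradient
at a maximum point, `S N` is the right-hand side of the equation there. -/
theorem gradient_bound_of_div_nonpos {p q γ v a b x y S T₁ T₂ N₁ N₂ ρ η : ℝ}
    (hq0 : 0 ≤ q) (hq2 : q < 2) (hκ : 2 * p ≤ (3 - q) * γ) (hv : 0 < v) (hS : 0 ≤ S)
    (hη : 0 < η) (hηρ : η = ρ ^ 2 - x ^ 2 - y ^ 2) (hN : 0 < a ^ 2 + b ^ 2)
    (h₁ : N₁ / (2 * (a ^ 2 + b ^ 2)) - γ * a / (2 * v) - 2 * x / η = 0)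
    (h₂ : N₂ / (2 * (a ^ 2 + b ^ 2)) - γ * b / (2 * v) - 2 * y / η = 0)
    (hT₁ : T₁ = S * ((q / 2 - 1) * N₁ / (a ^ 2 + b ^ 2) + p * a / v) - γ * a / (2 * v ^ 2))
    (hT₂ : T₂ = S * ((q / 2 - 1) * N₂ / (a ^ 2 + b ^ 2) + p * b / v) - γ * b / (2 * v ^ 2))
    (hdiv : -(T₁ * a + T₂ * b) + (S + γ / (2 * v)) * (S * (a ^ 2 + b ^ 2))
      - (4 / η + 4 * (x ^ 2 + y ^ 2) / η ^ 2) ≤ 0) :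
    γ * (a ^ 2 + b ^ 2) * η ^ 2 ≤ 16 * ρ ^ 2 * v ^ 2 := by
  set N := a ^ 2 + b ^ 2 with hNdef
  have e₁ : N₁ / N = γ * a / v + 4 * x / η := by
    have : N₁ / N = 2 * (N₁ / (2 * N)) := by field_simp
    rw [this]
    field_simp at h₁ ⊢
    linarith
  have e₂ : N₂ / N = γ * b / v + 4 * y / η := by
    have : N₂ / N = 2 * (N₂ / (2 * N)) := by field_simp
    rw [this]
    field_simp at h₂ ⊢
    linarith
  rw [mul_div_assoc, e₁] at hT₁
  rw [mul_div_assoc, e₂] at hT₂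
  have e₃ : 4 / η + 4 * (x ^ 2 + y ^ 2) / η ^ 2 = 4 * ρ ^ 2 / η ^ 2 := by
    field_simp
    rw [hηρ]
    ring
  set k := 1 - q / 2 with hk
  have e₄ : -(T₁ * a + T₂ * b) + (S + γ / (2 * v)) * (S * N)
      = (S * a + 2 * k * x / η) ^ 2 + (S * b + 2 * k * y / η) ^ 2
        - 4 * k ^ 2 * (x ^ 2 + y ^ 2) / η ^ 2
        + S * N / v * (((3 - q) * γ - 2 * p) / 2) + γ * N / (2 * v ^ 2) := by
    rw [hT₁, hT₂, hNdef, hk]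
    field_simp
    ring
  have h5 : 0 ≤ S * N / v * (((3 - q) * γ - 2 * p) / 2) :=
    mul_nonneg (by positivity) (by linarith)
  have h6 : 4 * k ^ 2 * (x ^ 2 + y ^ 2) / η ^ 2 ≤ 4 * ρ ^ 2 / η ^ 2 := by
    have hk1 : k ^ 2 ≤ 1 := by nlinarith
    have hr : k ^ 2 * (x ^ 2 + y ^ 2) ≤ 1 * (x ^ 2 + y ^ 2) :=
      mul_le_mul_of_nonneg_right hk1 (by positivity)
    gcongr 1
    linarith
  have h7 : γ * N / (2 * v ^ 2) ≤ 8 * ρ ^ 2 / η ^ 2 := by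
    have : 8 * ρ ^ 2 / η ^ 2 = 4 * ρ ^ 2 / η ^ 2 + 4 * ρ ^ 2 / η ^ 2 := by ring
    rw [e₄, e₃] at hdiv
    linarith [sq_nonneg (S * a + 2 * k * x / η), sq_nonneg (S * b + 2 * k * y / η)]
  rw [div_le_div_iff₀ (by positivity) (by positivity)] at h7
  linarith

open Filter Topology Complex in
theorem gradient_bound_at_max {v a b : ℂ → ℝ} {z₀ : ℂ} {p q γ ρ : ℝ}
    (hq0 : 0 ≤ q) (hq2 : q < 2) (hκ : 2 * p ≤ (3 - q) * γ)
    (ha : ContDiffAt ℝ 1 a z₀) (hb : ContDiffAt ℝ 1 b z₀) (hv : ContDiffAt ℝ 1 v z₀)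
    (hgrad : ∀ᶠ z in 𝓝 z₀, HasFDerivAt v (a z • reCLM + b z • imCLM) z)
    (hsymm : ∀ᶠ z in 𝓝 z₀, fderiv ℝ a z I = fderiv ℝ b z 1)
    (heq : ∀ᶠ z in 𝓝 z₀, fderiv ℝ a z 1 + fderiv ℝ b z I
      + (a z ^ 2 + b z ^ 2) ^ (q / 2) * v z ^ p = 0)
    (hv0 : 0 < v z₀) (hN0 : 0 < a z₀ ^ 2 + b z₀ ^ 2)
    (hη0 : 0 < ρ ^ 2 - z₀.re ^ 2 - z₀.im ^ 2)
    (hmax : IsLocalMax (fun z => Real.log (a z ^ 2 + b z ^ 2) / 2 - γ / 2 * Real.log (v z)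
      + Real.log (ρ ^ 2 - z.re ^ 2 - z.im ^ 2)) z₀) :
    γ * (a z₀ ^ 2 + b z₀ ^ 2) * (ρ ^ 2 - z₀.re ^ 2 - z₀.im ^ 2) ^ 2 ≤ 16 * ρ ^ 2 * v z₀ ^ 2 := by
  set W : ℂ → ℂ := fun z => a z - I * b z with hW
  set η : ℂ → ℝ := fun z => ρ ^ 2 - z.re ^ 2 - z.im ^ 2 with hη
  set ψ : ℂ → ℝ := fun z => - (γ / 2 * Real.log (v z)) + Real.log (η z) with hψ
  set N : ℂ → ℝ := fun z => a z ^ 2 + b z ^ 2 with hN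
  set S : ℂ → ℝ := fun z => N z ^ (q / 2 - 1) * v z ^ p with hS
  have hWsq : ∀ z, ‖W z‖ ^ 2 = N z := by
    intro z
    rw [← normSq_eq_norm_sq, normSq_apply]
    simp [hW, hN]; ring
  have hW0 : ∀ z, N z ≠ 0 → W z ≠ 0 := fun z hz h => hz (by rw [← hWsq, h]; simp)
  have hWC : ContDiffAt ℝ 1 W z₀ :=
    (ofRealCLM.contDiff.contDiffAt.comp z₀ ha).sub
      (contDiffAt_const.mul (ofRealCLM.contDiff.contDiffAt.comp z₀ hb))
  have hηC : ContDiff ℝ 1 η :=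
    (contDiff_const.sub (reCLM.contDiff.pow 2)).sub (imCLM.contDiff.pow 2)
  have hψC : ContDiffAt ℝ 1 ψ z₀ :=
    (contDiffAt_const.mul (hv.log hv0.ne')).neg.add (hηC.contDiffAt.log hη0.ne')
  have hquot : W z₀ / W z₀ = 1 := div_self (hW0 _ hN0.ne')
  have hquotC : ContDiffAt ℝ 1 (fun z => W z / W z₀) z₀ := by
    simp_rw [div_eq_mul_inv]
    exact hWC.mul contDiffAt_const
  have hLC : ContDiffAt ℝ 1 (fun z => Complex.log (W z / W z₀) + ψ z) z₀ := by
    refine ContDiffAt.add ?_ (ofRealCLM.contDiff.contDiffAt.comp z₀ hψC)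
    refine ContDiffAt.comp z₀ (g := Complex.log) ?_ hquotC
    rw [hquot]
    exact (contDiffAt_log one_mem_slitPlane).restrict_scalars ℝ
  have hNpos : ∀ᶠ z in 𝓝 z₀, 0 < N z :=
    ((ha.continuousAt.pow 2).add (hb.continuousAt.pow 2)).eventually_const_lt hN0
  have hvpos : ∀ᶠ z in 𝓝 z₀, 0 < v z := hv.continuousAt.eventually_const_lt hv0
  have hηpos : ∀ᶠ z in 𝓝 z₀, 0 < η z := hηC.continuous.continuousAt.eventually_const_lt hη0
  have hslit : ∀ᶠ z in 𝓝 z₀, W z / W z₀ ∈ slitPlane :=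
    hquotC.continuousAt.eventually_mem (isOpen_slitPlane.mem_nhds (by
      rw [hquot]; exact one_mem_slitPlane))
  have hηd : ∀ z, HasFDerivAt η (-(2 * z.re) • reCLM - (2 * z.im) • imCLM) z := by
    intro z
    have h := ((hasFDerivAt_const (ρ ^ 2) z).sub ((reCLM.hasFDerivAt (x := z)).pow 2)).sub
      ((imCLM.hasFDerivAt (x := z)).pow 2)
    exact h.congr_fderiv (by ext; simp)
  have hψd : ∀ᶠ z in 𝓝 z₀, HasFDerivAt ψ
      (-((γ / 2) • ((v z)⁻¹ • (a z • reCLM + b z • imCLM)))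
        + (η z)⁻¹ • (-(2 * z.re) • reCLM - (2 * z.im) • imCLM)) z := by
    filter_upwards [hgrad, hvpos, hηpos] with z h1 h2 h3
    exact ((h1.log h2.ne').const_mul (γ / 2)).neg.add ((hηd z).log h3.ne')
  have had : ∀ᶠ z in 𝓝 z₀, HasFDerivAt a (fderiv ℝ a z) z :=
    (ha.eventually (by simp)).mono fun z hz => (hz.differentiableAt one_ne_zero).hasFDerivAt
  have hbd : ∀ᶠ z in 𝓝 z₀, HasFDerivAt b (fderiv ℝ b z) z :=
    (hb.eventually (by simp)).mono fun z hz => (hz.differentiableAt one_ne_zero).hasFDerivAt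
  have hLd : ∀ᶠ z in 𝓝 z₀, HasFDerivAt (fun z => Complex.log (W z / W z₀) + ψ z)
      ((W z)⁻¹ • (ofRealCLM ∘L fderiv ℝ a z - I • (ofRealCLM ∘L fderiv ℝ b z))
        + ofRealCLM ∘L (-((γ / 2) • ((v z)⁻¹ • (a z • reCLM + b z • imCLM)))
        + (η z)⁻¹ • (-(2 * z.re) • reCLM - (2 * z.im) • imCLM))) z := by
    filter_upwards [had, hbd, hψd, hslit] with z h1 h2 h3 h4
    have h5 : HasFDerivAt W (ofRealCLM ∘L fderiv ℝ a z - I • (ofRealCLM ∘L fderiv ℝ b z)) z :=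
      (ofRealCLM.hasFDerivAt.comp z h1).sub ((ofRealCLM.hasFDerivAt.comp z h2).const_mul I)
    have h6 := ((hasStrictFDerivAt_log_real h4).hasFDerivAt.comp z (h5.mul_const (W z₀)⁻¹)).add
      (ofRealCLM.hasFDerivAt.comp z h3)
    refine h6.congr_fderiv ?_
    congr 1
    have hne := hW0 _ hN0.ne'
    ext; simp; field_simp
  have hlogre : ∀ᶠ z in 𝓝 z₀, (Complex.log (W z / W z₀) + ψ z).re
      = Real.log (N z) / 2 - γ / 2 * Real.log (v z) + Real.log (η z) - Real.log (N z₀) / 2 := by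
    filter_upwards [hNpos] with z hz
    rw [← hWsq, ← hWsq, Real.log_pow, Real.log_pow, add_re, log_re, ofReal_re, norm_div,
      Real.log_div (norm_ne_zero_iff.2 (hW0 _ hz.ne')) (norm_ne_zero_iff.2 (hW0 _ hN0.ne'))]
    simp only [hψ]
    push_cast
    ring
  have hLmax : IsLocalMax (fun z => (Complex.log (W z / W z₀) + ψ z).re) z₀ := by
    filter_upwards [hlogre, hmax] with z h1 h2
    rw [h1, hlogre.self_of_nhds]
    exact sub_le_sub_right h2 _
  have hNd : HasFDerivAt N ((2 * a z₀) • fderiv ℝ a z₀ + (2 * b z₀) • fderiv ℝ b z₀) z₀ := by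
    have := (had.self_of_nhds.pow 2).add (hbd.self_of_nhds.pow 2)
    exact this.congr_fderiv (by ext; simp)
  have hcrit : HasFDerivAt (fun z => Real.log (N z) / 2 - γ / 2 * Real.log (v z)
      + Real.log (η z)) _ z₀ :=
    (((hNd.log hN0.ne').mul_const (2⁻¹ : ℝ)).sub
      ((hgrad.self_of_nhds.log hv0.ne').const_mul (γ / 2))).add ((hηd z₀).log hη0.ne')
  have hcrit0 := hmax.hasFDerivAt_eq_zero hcrit
  have hc1 := congrArg (fun T : ℂ →L[ℝ] ℝ => T 1) hcrit0
  have hc2 := congrArg (fun T : ℂ →L[ℝ] ℝ => T I) hcrit0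
  set T : ℂ → ℝ := fun z => S z + γ / 2 * (v z)⁻¹ with hT
  obtain ⟨T', hTd, hT'⟩ : ∃ T' : ℂ →L[ℝ] ℝ, HasFDerivAt T T' z₀ ∧ ∀ w, T' w =
      S z₀ * ((q / 2 - 1) * ((2 * a z₀) * fderiv ℝ a z₀ w + (2 * b z₀) * fderiv ℝ b z₀ w) / N z₀
        + p * (a z₀ * w.re + b z₀ * w.im) / v z₀)
      - γ * (a z₀ * w.re + b z₀ * w.im) / (2 * v z₀ ^ 2) := by
    have h := ((hNd.rpow_const (p := q / 2 - 1) (Or.inl hN0.ne')).mul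
      (hgrad.self_of_nhds.rpow_const (p := p) (Or.inl hv0.ne'))).add
      (((hasDerivAt_inv hv0.ne').comp_hasFDerivAt z₀ hgrad.self_of_nhds).const_mul (γ / 2))
    refine ⟨_, h, fun w => ?_⟩
    have e1 : N z₀ ^ (q / 2 - 1 - 1) = N z₀ ^ (q / 2 - 1) / N z₀ := Real.rpow_sub_one hN0.ne' _
    have e2 : v z₀ ^ (p - 1) = v z₀ ^ p / v z₀ := Real.rpow_sub_one hv0.ne' _
    simp [e1, e2, hS]
    field_simp
    ring
  have hSN : ∀ z, 0 < N z → (a z ^ 2 + b z ^ 2) ^ (q / 2) * v z ^ p = S z * N z := by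
    intro z hz
    change N z ^ (q / 2) * v z ^ p = N z ^ (q / 2 - 1) * v z ^ p * N z
    rw [Real.rpow_sub_one hz.ne']
    field_simp
  obtain ⟨G₁, hG₁, hG₁'⟩ : ∃ G : ℂ →L[ℝ] ℝ,
      HasFDerivAt (fun z => T z * a z + 2 * z.re * (η z)⁻¹) G z₀ ∧
      G 1 = T' 1 * a z₀ + T z₀ * fderiv ℝ a z₀ 1 + 2 / η z₀ + 4 * z₀.re ^ 2 / η z₀ ^ 2 := by
    refine ⟨_, (hTd.mul had.self_of_nhds).add (((reCLM.hasFDerivAt (x := z₀)).const_mul 2).mul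
      ((hasDerivAt_inv hη0.ne').comp_hasFDerivAt z₀ (hηd z₀))), ?_⟩
    change _ * _ + _ * _ + (_ * (-(η z₀ ^ 2)⁻¹ * _) + (η z₀)⁻¹ * _) = _
    simp
    ring
  obtain ⟨G₂, hG₂, hG₂'⟩ : ∃ G : ℂ →L[ℝ] ℝ,
      HasFDerivAt (fun z => T z * b z + 2 * z.im * (η z)⁻¹) G z₀ ∧
      G I = T' I * b z₀ + T z₀ * fderiv ℝ b z₀ I + 2 / η z₀ + 4 * z₀.im ^ 2 / η z₀ ^ 2 := by
    refine ⟨_, (hTd.mul hbd.self_of_nhds).add (((imCLM.hasFDerivAt (x := z₀)).const_mul 2).mul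
      ((hasDerivAt_inv hη0.ne').comp_hasFDerivAt z₀ (hηd z₀))), ?_⟩
    change _ * _ + _ * _ + (_ * (-(η z₀ ^ 2)⁻¹ * _) + (η z₀)⁻¹ * _) = _
    simp
    ring
  have hH' := ((ofRealCLM.hasFDerivAt.comp z₀ hG₁).neg).sub
    ((ofRealCLM.hasFDerivAt.comp z₀ hG₂).const_mul I)
  have key := re_dbar_deriv_nonpos_of_isLocalMax hLC ?_ hH' hLmax
  · have hE := heq.self_of_nhds
    have hNz : N z₀ ≠ 0 := hN0.ne'
    have hηz : η z₀ ≠ 0 := hη0.ne'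
    rw [hSN z₀ hN0] at hE
    refine gradient_bound_of_div_nonpos (S := S z₀) (T₁ := T' 1) (T₂ := T' I)
      (N₁ := (2 * a z₀) * fderiv ℝ a z₀ 1 + (2 * b z₀) * fderiv ℝ b z₀ 1)
      (N₂ := (2 * a z₀) * fderiv ℝ a z₀ I + (2 * b z₀) * fderiv ℝ b z₀ I)
      hq0 hq2 hκ hv0 (by positivity) hη0 rfl hN0 ?_ ?_ ?_ ?_ ?_
    · simp at hc1
      rw [← hc1]
      change _ / (2 * N z₀) - _ - _ / η z₀ = _
      field_simp
      ring
    · simp at hc2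
      rw [← hc2]
      change _ / (2 * N z₀) - _ - _ / η z₀ = _
      field_simp
      ring
    · rw [hT']; simp [hN]
    · rw [hT']; simp [hN]
    · simp at key
      rw [hG₁', hG₂'] at key
      change _ + _ * (_ * N z₀) - (_ / η z₀ + _ / η z₀ ^ 2) ≤ 0
      have hTz : T z₀ = S z₀ + γ / (2 * v z₀) := by
        simp only [hT]
        field_simp
      rw [← hTz, show S z₀ * N z₀ = -(fderiv ℝ a z₀ 1 + fderiv ℝ b z₀ I) by linarith]
      refine le_of_eq_of_le ?_ (sub_nonpos.2 key)
      ring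
  · filter_upwards [hLd, hNpos, hvpos, hηpos, heq, hsymm] with z h1 h2 h3 h4 h5 h6
    rw [h1.fderiv]
    rw [hSN z h2] at h5
    have e1 : (W z)⁻¹ * (N z : ℂ) = a z + I * b z := by
      rw [inv_mul_eq_iff_eq_mul₀ (hW0 z h2.ne')]
      simp only [hW, hN]
      push_cast
      linear_combination (b z : ℂ) ^ 2 * I_sq
    have e2 : ((fderiv ℝ a z 1 : ℝ) : ℂ) - I * (fderiv ℝ b z 1 : ℝ)
        + I * ((fderiv ℝ a z I : ℝ) - I * (fderiv ℝ b z I : ℝ)) = -(S z * N z) := by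
      have h7 : ((fderiv ℝ a z 1 + fderiv ℝ b z I + S z * N z : ℝ) : ℂ) = 0 := by
        rw [h5, ofReal_zero]
      push_cast at h7
      rw [h6]
      linear_combination h7 - (fderiv ℝ b z I : ℂ) * I_sq
    simp [hT]
    linear_combination (W z)⁻¹ * e2 - S z * e1

open Filter Topology Complex in
theorem nonneg_of_laplacian_neg {w a b : ℂ → ℝ} {K U : Set ℂ} (hK : IsCompact K) (hU : IsOpen U)
    (hUK : U ⊆ K) (hw : ContinuousOn w K) (hbd : ∀ z ∈ K, z ∉ U → 0 ≤ w z)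
    (hC : ∀ z ∈ U, ContDiffAt ℝ 1 w z)
    (hd : ∀ z ∈ U, HasFDerivAt w (a z • reCLM + b z • imCLM) z)
    (hlap : ∀ z ∈ U, ∃ a' b' : ℂ →L[ℝ] ℝ, HasFDerivAt a a' z ∧ HasFDerivAt b b' z ∧
      a' 1 + b' I < 0) : ∀ z ∈ K, 0 ≤ w z := by
  intro z hz
  obtain ⟨z₁, hz₁, hmin⟩ := hK.exists_isMinOn ⟨z, hz⟩ hw
  refine le_trans ?_ (hmin hz)
  by_cases h : z₁ ∈ U
  · obtain ⟨a', b', ha, hb, hlt⟩ := hlap z₁ h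
    have hUz := hU.mem_nhds h
    have := laplacian_nonpos_of_isLocalMax (φ := fun z => -w z) (hC z₁ h).neg
      (a := fun z => -a z) (b := fun z => -b z) (a' := -a') (b' := -b') ?_ ha.neg hb.neg
      (hmin.isLocalMin (mem_of_superset hUz hUK)).neg
    · simp at this
      linarith
    · filter_upwards [hUz] with z hz
      exact (hd z hz).neg.congr_fderiv (by ext; simp; ring)
  · exact hbd z₁ hz₁ h

open Filter Topology Complex Metric in
theorem le_on_disc_of_superharmonic {v a b : ℂ → ℝ} {m r P : ℝ} (hrP : r < P)
    (hC : ∀ z ∈ ball (0 : ℂ) P, ContDiffAt ℝ 1 v z)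
    (ha : ∀ z ∈ ball (0 : ℂ) P, ContDiffAt ℝ 1 a z)
    (hb : ∀ z ∈ ball (0 : ℂ) P, ContDiffAt ℝ 1 b z)
    (hd : ∀ z ∈ ball (0 : ℂ) P, HasFDerivAt v (a z • reCLM + b z • imCLM) z)
    (hlap : ∀ z ∈ ball (0 : ℂ) P, fderiv ℝ a z 1 + fderiv ℝ b z I ≤ 0)
    (hm : ∀ z : ℂ, ‖z‖ = r → m ≤ v z) (z : ℂ) (hz : ‖z‖ ≤ r) : m ≤ v z := by
  have hsub : closedBall (0 : ℂ) r ⊆ ball 0 P := closedBall_subset_ball hrP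
  have hnd : ∀ z : ℂ, HasFDerivAt (fun z : ℂ => r ^ 2 - z.re ^ 2 - z.im ^ 2)
      (-(2 * z.re) • reCLM - (2 * z.im) • imCLM) z := fun z =>
    (((hasFDerivAt_const (r ^ 2) z).sub ((reCLM.hasFDerivAt (x := z)).pow 2)).sub
      ((imCLM.hasFDerivAt (x := z)).pow 2)).congr_fderiv (by ext; simp)
  have hnC : ContDiff ℝ 1 (fun z : ℂ => r ^ 2 - z.re ^ 2 - z.im ^ 2) :=
    (contDiff_const.sub (reCLM.contDiff.pow 2)).sub (imCLM.contDiff.pow 2)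
  have hε : ∀ ε > 0, m ≤ v z + ε * (r ^ 2 - z.re ^ 2 - z.im ^ 2) := by
    intro ε hε
    rw [← sub_nonneg]
    have hwC : ∀ z ∈ ball (0 : ℂ) P,
        ContDiffAt ℝ 1 (fun z => v z + ε * (r ^ 2 - z.re ^ 2 - z.im ^ 2) - m) z := fun z hz =>
      ((hC z hz).add (contDiffAt_const.mul hnC.contDiffAt)).sub contDiffAt_const
    refine nonneg_of_laplacian_neg (a := fun z => a z - ε * (2 * z.re))
      (b := fun z => b z - ε * (2 * z.im))
      (w := fun z => v z + ε * (r ^ 2 - z.re ^ 2 - z.im ^ 2) - m)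
      (isCompact_closedBall (0 : ℂ) r) isOpen_ball ball_subset_closedBall
      (fun z hz => (hwC z (hsub hz)).continuousAt.continuousWithinAt) ?_
      (fun z hz => hwC z (hsub (ball_subset_closedBall hz))) ?_ ?_ z (by simpa using hz)
    · intro z hz hz'
      have hzr : ‖z‖ = r := le_antisymm (by simpa using hz) (by simpa using hz')
      have : r ^ 2 = z.re ^ 2 + z.im ^ 2 := by
        rw [← hzr, ← normSq_eq_norm_sq, normSq_apply]
        ring
      have := hm z hzr
      rw [show r ^ 2 - z.re ^ 2 - z.im ^ 2 = 0 by linarith]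
      linarith
    · intro z hz
      have h := ((hd z (hsub (ball_subset_closedBall hz))).add
        ((hnd z).const_mul ε)).sub_const m
      exact h.congr_fderiv (by ext; simp; ring)
    · intro z hz
      have hz := hsub (ball_subset_closedBall hz)
      refine ⟨_, _, ((ha z hz).differentiableAt one_ne_zero).hasFDerivAt.sub
        ((reCLM.hasFDerivAt.const_mul 2).const_mul ε),
        ((hb z hz).differentiableAt one_ne_zero).hasFDerivAt.sub
        ((imCLM.hasFDerivAt.const_mul 2).const_mul ε), ?_⟩
      have := hlap z hz
      simp
      linarith
  have hlim : Tendsto (fun ε : ℝ => v z + ε * (r ^ 2 - z.re ^ 2 - z.im ^ 2)) (𝓝[>] 0)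
      (𝓝 (v z + 0 * (r ^ 2 - z.re ^ 2 - z.im ^ 2))) :=
    Tendsto.mono_left (Continuous.tendsto (by fun_prop) 0) nhdsWithin_le_nhds
  rw [zero_mul, add_zero] at hlim
  exact ge_of_tendsto hlim (by filter_upwards [self_mem_nhdsWithin] with ε h using hε ε h)

open Filter Topology Complex Metric in
theorem le_on_annulus_of_superharmonic {v a b : ℂ → ℝ} {m r ρ P σ : ℝ} (hr : 0 < r)
    (hρP : ρ < P) (hσ : 0 < σ) (hm0 : 0 < m)
    (hC : ∀ z ∈ ball (0 : ℂ) P, ContDiffAt ℝ 1 v z)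
    (ha : ∀ z ∈ ball (0 : ℂ) P, ContDiffAt ℝ 1 a z)
    (hb : ∀ z ∈ ball (0 : ℂ) P, ContDiffAt ℝ 1 b z)
    (hd : ∀ z ∈ ball (0 : ℂ) P, HasFDerivAt v (a z • reCLM + b z • imCLM) z)
    (hlap : ∀ z ∈ ball (0 : ℂ) P, fderiv ℝ a z 1 + fderiv ℝ b z I ≤ 0)
    (hpos : ∀ z ∈ ball (0 : ℂ) P, 0 ≤ v z)
    (hm : ∀ z : ℂ, ‖z‖ = r → m ≤ v z) (z : ℂ) (hz : r ≤ ‖z‖) (hzρ : ‖z‖ ≤ ρ) :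
    m * (r ^ 2) ^ σ * ((‖z‖ ^ 2) ^ (-σ) - (ρ ^ 2) ^ (-σ)) ≤ v z := by
  set k := m * (r ^ 2) ^ σ with hk
  have hk0 : 0 < k := by positivity
  set N : ℂ → ℝ := fun z => z.re ^ 2 + z.im ^ 2 with hN
  have hNn : ∀ z, ‖z‖ ^ 2 = N z := fun z => by
    rw [← normSq_eq_norm_sq, normSq_apply]
    ring
  have hNpos : ∀ z : ℂ, r ≤ ‖z‖ → 0 < N z := fun z hz => by
    rw [← hNn]
    have : 0 < ‖z‖ := hr.trans_le hz
    positivity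
  have hNd : ∀ z : ℂ, HasFDerivAt N ((2 * z.re) • reCLM + (2 * z.im) • imCLM) z := fun z =>
    (((reCLM.hasFDerivAt (x := z)).pow 2).add ((imCLM.hasFDerivAt (x := z)).pow 2)).congr_fderiv
      (by ext; simp)
  have hNC : ContDiff ℝ 1 N := (reCLM.contDiff.pow 2).add (imCLM.contDiff.pow 2)
  have hwC : ∀ z ∈ ball (0 : ℂ) P, r ≤ ‖z‖ →
      ContDiffAt ℝ 1 (fun z => v z - k * (N z ^ (-σ) - (ρ ^ 2) ^ (-σ))) z := fun z hz hz' =>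
    (hC z hz).sub (contDiffAt_const.mul
      ((hNC.contDiffAt.rpow_const_of_ne (hNpos z hz').ne').sub contDiffAt_const))
  rw [hNn, ← sub_nonneg]
  have hKb : closedBall (0 : ℂ) ρ ⊆ ball 0 P := closedBall_subset_ball hρP
  have hKc : IsClosed {z : ℂ | r ≤ ‖z‖} := isClosed_le continuous_const continuous_norm
  have hUo : IsOpen {z : ℂ | r < ‖z‖} := isOpen_lt continuous_const continuous_norm
  refine nonneg_of_laplacian_neg
    (a := fun z => a z + (2 * k * σ) * (z.re * N z ^ (-σ - 1)))
    (b := fun z => b z + (2 * k * σ) * (z.im * N z ^ (-σ - 1)))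
    (w := fun z => v z - k * (N z ^ (-σ) - (ρ ^ 2) ^ (-σ)))
    ((isCompact_closedBall (0 : ℂ) ρ).inter_right hKc)
    (isOpen_ball.inter hUo)
    (Set.inter_subset_inter ball_subset_closedBall fun z (hz : r < ‖z‖) => hz.le)
    (fun z hz => (hwC z (hKb hz.1) hz.2).continuousAt.continuousWithinAt) ?_
    (fun z hz => hwC z (hKb (ball_subset_closedBall hz.1)) (le_of_lt hz.2)) ?_ ?_ z
    ⟨by simpa using hzρ, hz⟩
  · rintro z ⟨hz1, hz2⟩ hz'
    have hz1' : ‖z‖ ≤ ρ := by simpa using hz1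
    rw [← hNn]
    rcases eq_or_lt_of_le (show r ≤ ‖z‖ from hz2) with h | h
    · rw [← h]
      have h1 := hm z h.symm
      have h2 : k * (r ^ 2) ^ (-σ) = m := by
        rw [hk, mul_assoc, ← Real.rpow_add (by positivity)]
        simp
      have h3 : 0 ≤ k * (ρ ^ 2) ^ (-σ) := by positivity
      linarith
    · have h3 : ‖z‖ = ρ := by
        refine le_antisymm hz1' (not_lt.1 fun h4 => hz' ⟨by simpa using h4, h⟩)
      rw [h3]
      simpa using hpos z (hKb hz1)
  · rintro z ⟨hz1, hz2⟩
    have h := (hd z (hKb (ball_subset_closedBall hz1))).sub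
      ((((hNd z).rpow_const (p := -σ) (Or.inl (hNpos z (le_of_lt hz2)).ne')).sub_const
        ((ρ ^ 2) ^ (-σ))).const_mul k)
    exact h.congr_fderiv (by ext; simp; ring)
  · rintro z ⟨hz1, hz2⟩
    have hz := hKb (ball_subset_closedBall hz1)
    have hN0 := hNpos z (le_of_lt hz2)
    have hp := (hNd z).rpow_const (p := -σ - 1) (Or.inl hN0.ne')
    refine ⟨_, _, ((ha z hz).differentiableAt one_ne_zero).hasFDerivAt.add
      ((reCLM.hasFDerivAt.mul hp).const_mul (2 * k * σ)),
      ((hb z hz).differentiableAt one_ne_zero).hasFDerivAt.add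
      ((imCLM.hasFDerivAt.mul hp).const_mul (2 * k * σ)), ?_⟩
    have h1 := hlap z hz
    have e1 : N z ^ (-σ - 1) = N z ^ (-σ - 1 - 1) * N z := by
      rw [Real.rpow_sub_one hN0.ne' (-σ - 1)]
      field_simp
    have h2 : 0 < 4 * k * σ ^ 2 * (N z ^ (-σ - 1 - 1) * N z) := by positivity
    have e2 : N z = z.re ^ 2 + z.im ^ 2 := rfl
    refine lt_of_le_of_lt (le_of_eq_of_le ?_ (add_le_add_left h1
      (-(4 * k * σ ^ 2 * (N z ^ (-σ - 1 - 1) * N z))))) (by linarith)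
    simp [e1]
    rw [e2]
    ring

open Filter Topology Complex Metric in
theorem le_of_superharmonic {v a b : ℂ → ℝ} {m r R σ : ℝ} (hr : 0 < r) (hrR : r ≤ R)
    (hσ : 0 < σ) (hm0 : 0 < m)
    (hC : ∀ z ∈ ball (0 : ℂ) (2 * R), ContDiffAt ℝ 1 v z)
    (ha : ∀ z ∈ ball (0 : ℂ) (2 * R), ContDiffAt ℝ 1 a z)
    (hb : ∀ z ∈ ball (0 : ℂ) (2 * R), ContDiffAt ℝ 1 b z)
    (hd : ∀ z ∈ ball (0 : ℂ) (2 * R), HasFDerivAt v (a z • reCLM + b z • imCLM) z)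
    (hlap : ∀ z ∈ ball (0 : ℂ) (2 * R), fderiv ℝ a z 1 + fderiv ℝ b z I ≤ 0)
    (hpos : ∀ z ∈ ball (0 : ℂ) (2 * R), 0 < v z)
    (hm : ∀ z : ℂ, ‖z‖ = r → m ≤ v z) (z : ℂ) (hz : ‖z‖ ≤ 3 / 2 * R) :
    m * ((r ^ 2) ^ σ * (R ^ 2) ^ (-σ)) * ((9 / 4) ^ (-σ) - (49 / 16) ^ (-σ)) ≤ v z := by
  have hR : 0 < R := hr.trans_le hrR
  rcases le_total ‖z‖ r with h | h
  · refine le_trans ?_ (le_on_disc_of_superharmonic (by linarith) hC ha hb hd hlap hm z h)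
    have h1 : (r ^ 2) ^ σ * (R ^ 2) ^ (-σ) ≤ 1 := by
      rw [Real.rpow_neg (by positivity), ← div_eq_mul_inv]
      exact div_le_one_of_le₀ (by gcongr) (by positivity)
    have h2 : (9 / 4 : ℝ) ^ (-σ) - (49 / 16) ^ (-σ) ≤ 1 := by
      have h3 : (9 / 4 : ℝ) ^ (-σ) ≤ 1 :=
        Real.rpow_le_one_of_one_le_of_nonpos (by norm_num) (by linarith)
      have h4 : (0 : ℝ) ≤ (49 / 16) ^ (-σ) := by positivity
      linarith
    have h5 : m * ((r ^ 2) ^ σ * (R ^ 2) ^ (-σ)) ≤ m := mul_le_of_le_one_right hm0.le h1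
    exact (mul_le_of_le_one_right (by positivity) h2).trans h5
  · refine le_trans ?_ (le_on_annulus_of_superharmonic (ρ := 7 / 4 * R) hr (by linarith) hσ hm0
      hC ha hb hd hlap (fun z hz => (hpos z hz).le) hm z h (by linarith))
    have h1 : (9 / 4 * R ^ 2) ^ (-σ) ≤ (‖z‖ ^ 2) ^ (-σ) := by
      have h0 : 0 < ‖z‖ := hr.trans_le h
      refine Real.rpow_le_rpow_of_nonpos (by positivity) ?_ (by linarith)
      nlinarith
    have h2 : ((7 / 4 * R) ^ 2) ^ (-σ) = (49 / 16) ^ (-σ) * (R ^ 2) ^ (-σ) := by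
      rw [← Real.mul_rpow (by positivity) (by positivity)]
      ring_nf
    rw [Real.mul_rpow (by positivity) (by positivity)] at h1
    rw [h2, mul_assoc, mul_assoc, mul_assoc]
    gcongr m * (_ * ?_)
    linarith

open Filter Topology Complex Metric in
theorem gradient_estimate_complex {v a b : ℂ → ℝ} {p q β m r R : ℝ}
    (hq0 : 0 ≤ q) (hq2 : q < 2) (hβ : 0 < β) (hκ : 2 * p ≤ (3 - q) * (β + 2))
    (hr : 0 < r) (hrR : r ≤ R) (hm0 : 0 < m)
    (hv : ∀ z ∈ ball (0 : ℂ) (2 * R), ContDiffAt ℝ 1 v z)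
    (ha : ∀ z ∈ ball (0 : ℂ) (2 * R), ContDiffAt ℝ 1 a z)
    (hb : ∀ z ∈ ball (0 : ℂ) (2 * R), ContDiffAt ℝ 1 b z)
    (hgrad : ∀ z ∈ ball (0 : ℂ) (2 * R), HasFDerivAt v (a z • reCLM + b z • imCLM) z)
    (hsymm : ∀ z ∈ ball (0 : ℂ) (2 * R), fderiv ℝ a z I = fderiv ℝ b z 1)
    (heq : ∀ z ∈ ball (0 : ℂ) (2 * R), fderiv ℝ a z 1 + fderiv ℝ b z I
      + (a z ^ 2 + b z ^ 2) ^ (q / 2) * v z ^ p = 0)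
    (hpos : ∀ z ∈ ball (0 : ℂ) (2 * R), 0 < v z)
    (hm : ∀ z : ℂ, ‖z‖ = r → m ≤ v z) (z : ℂ) (hz : ‖z‖ < R) :
    v z ^ (-β) * ((a z ^ 2 + b z ^ 2) / v z ^ 2) ≤
      576 / (25 * (β + 2))
        * ((9 / 4) ^ (-(1 / (2 * β))) - (49 / 16) ^ (-(1 / (2 * β)))) ^ (-β) / (R * r)
        * m ^ (-β) := by
  have hR : 0 < R := hr.trans_le hrR
  set σ := 1 / (2 * β) with hσ
  have hσ0 : 0 < σ := by positivity
  set c : ℝ := (9 / 4) ^ (-σ) - (49 / 16) ^ (-σ) with hc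
  have hc0 : 0 < c :=
    sub_pos.2 (Real.rpow_lt_rpow_of_neg (by norm_num) (by norm_num) (by linarith))
  set D := m * ((r ^ 2) ^ σ * (R ^ 2) ^ (-σ)) * c with hD
  have hD0 : 0 < D := by positivity
  have hDv : ∀ z : ℂ, ‖z‖ ≤ 3 / 2 * R → D ≤ v z :=
    le_of_superharmonic hr hrR hσ0 hm0 hv ha hb hgrad (fun z hz => by
      have h1 := heq z hz
      have h2 := hpos z hz
      have h3 : 0 ≤ (a z ^ 2 + b z ^ 2) ^ (q / 2) * v z ^ p := by positivity
      linarith) hpos hm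
  have hDβ : D ^ (-β) = m ^ (-β) * (R / r) * c ^ (-β) := by
    have e1 : (r ^ 2) ^ (σ * -β) = r⁻¹ := by
      rw [show σ * -β = 2⁻¹ * (-1) by rw [hσ]; field_simp, Real.rpow_mul (by positivity),
        ← Real.rpow_natCast, ← Real.rpow_mul hr.le]
      simp [Real.rpow_neg_one]
    have e2 : (R ^ 2) ^ (-σ * -β) = R := by
      rw [show -σ * -β = 2⁻¹ by rw [hσ]; field_simp, ← Real.rpow_natCast, ← Real.rpow_mul hR.le]
      simp
    rw [hD, Real.mul_rpow (by positivity) hc0.le, Real.mul_rpow hm0.le (by positivity),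
      Real.mul_rpow (by positivity) (by positivity), ← Real.rpow_mul (by positivity),
      ← Real.rpow_mul (by positivity), e1, e2]
    ring
  set ρ := 3 / 2 * R with hρ
  have hKb : closedBall (0 : ℂ) ρ ⊆ ball 0 (2 * R) := closedBall_subset_ball (by linarith)
  set η : ℂ → ℝ := fun z => ρ ^ 2 - z.re ^ 2 - z.im ^ 2 with hη
  have hηn : ∀ z, η z = ρ ^ 2 - ‖z‖ ^ 2 := fun z => by
    rw [← normSq_eq_norm_sq, normSq_apply]
    ring
  have hηC : Continuous η := by fun_prop
  set N : ℂ → ℝ := fun z => a z ^ 2 + b z ^ 2 with hN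
  set G : ℂ → ℝ := fun z => η z ^ 2 * N z * v z ^ (-(β + 2)) with hG
  have hGC : ContinuousOn G (closedBall 0 ρ) := fun w hw => by
    have hw := hKb hw
    refine ContinuousAt.continuousWithinAt ?_
    exact ((hηC.continuousAt.pow 2).mul (((ha w hw).continuousAt.pow 2).add
      ((hb w hw).continuousAt.pow 2))).mul
      ((hv w hw).continuousAt.rpow_const (Or.inl (hpos w hw).ne'))
  have hzK : z ∈ closedBall (0 : ℂ) ρ := by
    simp only [mem_closedBall, dist_zero_right]
    linarith
  obtain ⟨z₁, hz₁, hmax⟩ := (isCompact_closedBall (0 : ℂ) ρ).exists_isMaxOn ⟨z, hzK⟩ hGC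
  have hv₁ := hpos z₁ (hKb hz₁)
  have hvz := hpos z (hKb hzK)
  have hrw : ∀ w, 0 < v w → v w ^ (-(β + 2)) = v w ^ (-β) / v w ^ 2 := fun w hw => by
    rw [neg_add', Real.rpow_sub hw]
    norm_num
  have hGle : G z₁ ≤ 36 * R ^ 2 / (β + 2) * D ^ (-β) := by
    by_cases h0 : N z₁ = 0 ∨ η z₁ = 0
    · have : G z₁ = 0 := by
        rcases h0 with h0 | h0 <;> simp [hG, h0]
      rw [this]
      positivity
    · push Not at h0
      have hN0 : 0 < N z₁ := lt_of_le_of_ne (by positivity) h0.1.symm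
      have hz₁' : ‖z₁‖ ≤ ρ := by simpa using hz₁
      have hη0 : 0 < η z₁ := by
        refine lt_of_le_of_ne ?_ h0.2.symm
        rw [hηn, sub_nonneg]
        gcongr
      have hz₁b : z₁ ∈ ball (0 : ℂ) ρ := by
        rw [mem_ball_zero_iff]
        refine lt_of_le_of_ne hz₁' fun h => h0.2 ?_
        rw [hηn, h, sub_self]
      have hnhds : ball (0 : ℂ) (2 * R) ∈ 𝓝 z₁ := isOpen_ball.mem_nhds (hKb hz₁)
      have hNev : ∀ᶠ w in 𝓝 z₁, 0 < N w :=
        (((ha _ (hKb hz₁)).continuousAt.pow 2).add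
          ((hb _ (hKb hz₁)).continuousAt.pow 2)).eventually_const_lt hN0
      have hηev : ∀ᶠ w in 𝓝 z₁, 0 < η w := hηC.continuousAt.eventually_const_lt hη0
      have hlog : ∀ w, 0 < η w → 0 < N w → 0 < v w →
          Real.log (N w) / 2 - (β + 2) / 2 * Real.log (v w) + Real.log (η w)
            = Real.log (G w) / 2 := fun w h1 h2 h3 => by
        simp only [hG]
        rw [Real.log_mul (by positivity) (by positivity),
          Real.log_mul (by positivity) (by positivity), Real.log_pow, Real.log_rpow h3]
        push_cast
        ring
      have hkey := gradient_bound_at_max (ρ := ρ) hq0 hq2 hκ (ha _ (hKb hz₁)) (hb _ (hKb hz₁))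
        (hv _ (hKb hz₁)) (mem_of_superset hnhds hgrad) (mem_of_superset hnhds hsymm)
        (mem_of_superset hnhds heq) hv₁ hN0 hη0 (by
          filter_upwards [hNev, hηev, hnhds, isOpen_ball.mem_nhds hz₁b] with w h1 h2 h3 h4
          have h5 := hpos w h3
          have e1 := hlog w h2 h1 h5
          have e2 := hlog z₁ hη0 hN0 hv₁
          refine e1.le.trans (le_trans ?_ e2.ge)
          have h6 : G w ≤ G z₁ := hmax (ball_subset_closedBall h4)
          have h7 : 0 < G w := by simp only [hG]; positivity
          gcongr)
      change (β + 2) * N z₁ * η z₁ ^ 2 ≤ _ at hkey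
      have h8 : v z₁ ^ (-β) ≤ D ^ (-β) :=
        Real.rpow_le_rpow_of_nonpos hD0 (hDv _ hz₁') (by linarith)
      calc G z₁ = (β + 2) * N z₁ * η z₁ ^ 2 * (v z₁ ^ (-β) / v z₁ ^ 2 / (β + 2)) := by
            simp only [hG]
            rw [hrw _ hv₁]
            field_simp
        _ ≤ 16 * ρ ^ 2 * v z₁ ^ 2 * (v z₁ ^ (-β) / v z₁ ^ 2 / (β + 2)) := by gcongr
        _ = 36 * R ^ 2 / (β + 2) * v z₁ ^ (-β) := by
            rw [hρ]
            field_simp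
            ring
        _ ≤ _ := by gcongr
  have hηz : 5 / 4 * R ^ 2 ≤ η z := by
    rw [hηn, hρ]
    have : ‖z‖ ^ 2 ≤ R ^ 2 := by gcongr
    linarith
  have hGz : (5 / 4 * R ^ 2) ^ 2 * N z * v z ^ (-(β + 2)) ≤ G z := by
    simp only [hG]
    gcongr
  have h9 := hGz.trans ((hmax hzK).trans hGle)
  rw [hDβ, hrw _ hvz] at h9
  have e3 : v z ^ (-β) * (N z / v z ^ 2) =
      (5 / 4 * R ^ 2) ^ 2 * N z * (v z ^ (-β) / v z ^ 2) * (16 / (25 * R ^ 4)) := by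
    field_simp
    ring
  change v z ^ (-β) * (N z / v z ^ 2) ≤ _
  rw [e3]
  refine (mul_le_mul_of_nonneg_right h9 (by positivity)).trans (le_of_eq ?_)
  field_simp
  ring

open Filter Topology Complex Metric in
theorem gradient_estimate_plane {p q β : ℝ} (hq0 : 0 ≤ q) (hq2 : q < 2) (hβ : 0 < β)
    (hκ : 2 * p ≤ (3 - q) * (β + 2)) {x₀ : EuclideanSpace ℝ (Fin 2)} {R : ℝ}
    {u : EuclideanSpace ℝ (Fin 2) → ℝ} (hu : ContDiffOn ℝ 2 u (ball x₀ (2 * R)))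
    (hpos : ∀ x ∈ ball x₀ (2 * R), 0 < u x)
    (heq : ∀ x ∈ ball x₀ (2 * R), elaplacian u x + ‖gradient u x‖ ^ q * u x ^ p = 0)
    {r : ℝ} (hr : 0 < r) (hrR : r ≤ R) {x : EuclideanSpace ℝ (Fin 2)} (hx : x ∈ ball x₀ R) :
    u x ^ (-β) * (‖gradient u x‖ ^ 2 / u x ^ 2) ≤
      576 / (25 * (β + 2))
        * ((9 / 4) ^ (-(1 / (2 * β))) - (49 / 16) ^ (-(1 / (2 * β)))) ^ (-β) / (R * r)
        * sInf (u '' sphere x₀ r) ^ (-β) := by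
  set T : ℂ ≃ₗᵢ[ℝ] EuclideanSpace ℝ (Fin 2) := orthonormalBasisOneI.repr with hT
  have hT1 : T 1 = EuclideanSpace.single 0 1 := by
    have := orthonormalBasisOneI.repr_self 0
    simpa using this
  have hTI : T I = EuclideanSpace.single 1 1 := by
    have := orthonormalBasisOneI.repr_self 1
    simpa using this
  have hTz : ∀ w : ℂ, T w = w.re • EuclideanSpace.single 0 1 + w.im • EuclideanSpace.single 1 1 :=
    fun w => by
      rw [← hT1, ← hTI, ← map_smul, ← map_smul, ← map_add]
      simp [re_add_im]
  set A : ℂ → EuclideanSpace ℝ (Fin 2) := fun z => x₀ + T z with hA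
  set L : ℂ →L[ℝ] EuclideanSpace ℝ (Fin 2) :=
    ((T : ℂ ≃L[ℝ] EuclideanSpace ℝ (Fin 2)) : ℂ →L[ℝ] EuclideanSpace ℝ (Fin 2)) with hL
  have hLT : ∀ z, L z = T z := fun z => rfl
  have hAd : ∀ z, HasFDerivAt A L z := fun z => L.hasFDerivAt.const_add x₀
  have hAC : ContDiff ℝ 2 A := contDiff_const.add L.contDiff
  have hAball : ∀ z ∈ ball (0 : ℂ) (2 * R), A z ∈ ball x₀ (2 * R) := fun z hz => by
    simpa [hA] using hz
  have huC : ∀ y ∈ ball x₀ (2 * R), ContDiffAt ℝ 2 u y := fun y hy =>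
    hu.contDiffAt (isOpen_ball.mem_nhds hy)
  have hud : ∀ y ∈ ball x₀ (2 * R), HasFDerivAt u (fderiv ℝ u y) y := fun y hy =>
    ((huC y hy).differentiableAt two_ne_zero).hasFDerivAt
  have hu'C : ∀ y ∈ ball x₀ (2 * R), ∀ e, ContDiffAt ℝ 1 (fun y => fderiv ℝ u y e) y :=
    fun y hy e => ((huC y hy).fderiv_right (m := 1) (by norm_num)).clm_apply contDiffAt_const
  set a : ℂ → ℝ := fun z => fderiv ℝ u (A z) (EuclideanSpace.single 0 1) with ha
  set b : ℂ → ℝ := fun z => fderiv ℝ u (A z) (EuclideanSpace.single 1 1) with hb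
  have hu'd : ∀ z ∈ ball (0 : ℂ) (2 * R), ∀ e w,
      fderiv ℝ (fun z => fderiv ℝ u (A z) e) z w
        = fderiv ℝ (fun y => fderiv ℝ u y e) (A z) (T w) := fun z hz e w => by
    have := ((hu'C _ (hAball z hz) e).differentiableAt one_ne_zero).hasFDerivAt.comp z (hAd z)
    exact congrArg (fun T : ℂ →L[ℝ] ℝ => T w) this.fderiv
  have hnorm : ∀ y, ‖gradient u y‖ ^ 2 = fderiv ℝ u y (EuclideanSpace.single 0 1) ^ 2
      + fderiv ℝ u y (EuclideanSpace.single 1 1) ^ 2 := fun y => by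
    have h : ∀ i, gradient u y i = fderiv ℝ u y (EuclideanSpace.single i 1) := fun i => by
      rw [← InnerProductSpace.toDual_symm_apply (𝕜 := ℝ) (x := EuclideanSpace.single i 1),
        EuclideanSpace.inner_single_right]
      simp [gradient]
    rw [EuclideanSpace.norm_sq_eq, Fin.sum_univ_two, h, h, Real.norm_eq_abs, Real.norm_eq_abs,
      sq_abs, sq_abs]
  have hm := (isCompact_sphere x₀ r).image_of_continuousOn (hu.continuousOn.mono
    (sphere_subset_closedBall.trans (closedBall_subset_ball (by linarith))))
  have hne : (u '' sphere x₀ r).Nonempty := (NormedSpace.sphere_nonempty.2 hr.le).image u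
  have hm0 : 0 < sInf (u '' sphere x₀ r) := by
    obtain ⟨y, hy, hy'⟩ := hm.sInf_mem hne
    rw [← hy']
    exact hpos y (closedBall_subset_ball (by linarith) (sphere_subset_closedBall hy))
  have hAx : A (T.symm (x - x₀)) = x := by simp [hA]
  have key := gradient_estimate_complex (v := fun z => u (A z)) (a := a) (b := b)
    hq0 hq2 hβ hκ hr hrR hm0
    (fun z hz => ((huC _ (hAball z hz)).comp z hAC.contDiffAt).of_le (by norm_num))
    (fun z hz => (hu'C _ (hAball z hz) _).comp z (hAC.contDiffAt.of_le (by norm_num)))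
    (fun z hz => (hu'C _ (hAball z hz) _).comp z (hAC.contDiffAt.of_le (by norm_num)))
    (fun z hz => ((hud _ (hAball z hz)).comp z (hAd z)).congr_fderiv (by
      ext w
      simp [ha, hb, hLT, hTz, mul_comm]))
    (fun z hz => by
      rw [hu'd z hz, hu'd z hz, hT1, hTI]
      have hdd := ((huC _ (hAball z hz)).fderiv_right (m := 1)
        (by norm_num)).differentiableAt one_ne_zero
      rw [fderiv_clm_apply hdd (differentiableAt_const _),
        fderiv_clm_apply hdd (differentiableAt_const _)]
      simpa using (huC _ (hAball z hz)).isSymmSndFDerivAt (by simp) _ _)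
    (fun z hz => by
      have h := heq _ (hAball z hz)
      rw [hu'd z hz, hu'd z hz, hT1, hTI]
      rw [elaplacian, Fin.sum_univ_two] at h
      simp only [ha, hb]
      rw [← hnorm, ← Real.rpow_natCast, ← Real.rpow_mul (norm_nonneg _)]
      convert h using 4
      push_cast
      ring)
    (fun z hz => hpos _ (hAball z hz))
    (fun z hz => csInf_le hm.bddBelow ⟨A z, by simpa [hA] using hz, rfl⟩)
    (T.symm (x - x₀)) (by
      rw [T.symm.norm_map, ← dist_eq_norm]
      exact hx)
  simp only [ha, hb, hAx, ← hnorm] at key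
  exact key

/-- **Theorem 2.6 (Euclidean case, `n = 2`).** For `q ∈ [0,2)` and `p ∈ ℝ` there exist
`β = β(p,q) ≥ 0` and `C = C(p,q) > 0` such that every positive classical solution of
`Δu + |∇u|^q u^p = 0` on `B(x₀, 2R) ⊂ ℝ²` satisfies, for every `0 < r ≤ R`,
`sup_(B(x₀,R)) u^(−β) |∇ln u|² ≤ (C/(R·r)) (min_(∂B(x₀,r)) u)^(−β)`. -/
theorem two_dim_gradient_estimate (p q : ℝ) (hq0 : 0 ≤ q) (hq2 : q < 2) :
    ∃ β ≥ (0 : ℝ), ∃ C > (0 : ℝ),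
      ∀ (x₀ : EuclideanSpace ℝ (Fin 2)) (R : ℝ), 0 < R →
      ∀ u : EuclideanSpace ℝ (Fin 2) → ℝ,
        ContDiffOn ℝ 2 u (Metric.ball x₀ (2 * R)) →
        (∀ x ∈ Metric.ball x₀ (2 * R), 0 < u x) →
        (∀ x ∈ Metric.ball x₀ (2 * R),
          elaplacian u x + ‖gradient u x‖ ^ q * u x ^ p = 0) →
        ∀ r : ℝ, 0 < r → r ≤ R →
        ∀ x ∈ Metric.ball x₀ R,
          u x ^ (-β) * (‖gradient u x‖ ^ 2 / u x ^ 2)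
            ≤ C / (R * r) * (sInf (u '' Metric.sphere x₀ r)) ^ (-β) := by
  have hβ : 0 < 1 + 2 * |p| := by positivity
  have hc : (0 : ℝ) < (9 / 4) ^ (-(1 / (2 * (1 + 2 * |p|))))
      - (49 / 16) ^ (-(1 / (2 * (1 + 2 * |p|)))) :=
    sub_pos.2 (Real.rpow_lt_rpow_of_neg (by norm_num) (by norm_num)
      (neg_neg_of_pos (by positivity)))
  have hκ : 2 * p ≤ (3 - q) * (1 + 2 * |p| + 2) := by
    nlinarith [le_abs_self p, abs_nonneg p]
  exact ⟨1 + 2 * |p|, hβ.le, 576 / (25 * (1 + 2 * |p| + 2)) *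
    ((9 / 4) ^ (-(1 / (2 * (1 + 2 * |p|)))) - (49 / 16) ^ (-(1 / (2 * (1 + 2 * |p|)))))
      ^ (-(1 + 2 * |p|)), by positivity, fun x₀ R _ u hu hpos heq r hr hrR x hx =>
    gradient_estimate_plane hq0 hq2 hβ hκ hu hpos heq hr hrR hx⟩
end
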